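/- arXiv:1608.03335 — 2 statements merged into one kernel-verified Lean document; each statement's English description precedes it below -/
import Mathlib

section
/- Suppose there is T₀ > 0 such that for every z ∈ Z and every pair of points y¹, y² ∈ Y_z there exists a control steering the reduced system y′(τ) = f(u(τ),y(τ)) from y¹ to y² in a finite time T(y¹,y²,z) ≤ T₀. Then there exists β(S) → 0 as S → ∞ (one can take β of order 1/S) such that sup_{μ∈W(z)} ρ(μ, M_z(S,y₀)) ≤ β(S) for all y₀ ∈ Y_z and all z ∈ Z. -/
open MeasureTheory Set Filter Metric
open scoped ENNReal NNReal Topology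

noncomputable section

namespace SlowObs

abbrev Dd (d : ℕ) := EuclideanSpace ℝ (Fin d)
abbrev Em (m : ℕ) := EuclideanSpace ℝ (Fin m)
abbrev Kk (k : ℕ) := EuclideanSpace ℝ (Fin k)

variable {d m k : ℕ}

/-- A control: a measurable function with values in `U` at nonnegative times. -/
def IsControl (U : Set (Dd d)) (u : ℝ → Dd d) : Prop :=
  Measurable u ∧ ∀ t : ℝ, 0 ≤ t → u t ∈ U

/-- Carathéodory (integral-form) solution of `y'(t) = vf t (y t)` on `[0, ∞)`. -/
def IsSolOn (vf : ℝ → Em m → Em m) (y : ℝ → Em m) : Prop :=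
  ContinuousOn y (Ici 0) ∧
    (∀ T : ℝ, IntervalIntegrable (fun s => vf s (y s)) volume 0 T) ∧
    ∀ t : ℝ, 0 ≤ t → y t = y 0 + ∫ s in (0:ℝ)..t, vf s (y s)

/-- The level sets `Y_z = {y : F y = z}` (invariant sets of the reduced system). -/
def lvl (F : Em m → Kk k) (z : Kk k) : Set (Em m) := {y | F y = z}

/-- `h(u,y) := F'(y) g(u,y)`. -/
def hObs (F : Em m → Kk k) (g : Dd d → Em m → Em m) (p : Dd d × Em m) : Kk k :=
  fderiv ℝ F p.2 (g p.1 p.2)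

/-- Occupational measure generated on `[0,S]` by the pair `(u(·), y(·))`:
the pushforward of the normalized Lebesgue measure on `[0,S]` under `τ ↦ (u τ, y τ)`. -/
def occ (u : ℝ → Dd d) (y : ℝ → Em m) (S : ℝ) : Measure (Dd d × Em m) :=
  (ENNReal.ofReal S)⁻¹ • Measure.map (fun τ => (u τ, y τ)) (volume.restrict (Ioc 0 S))

/-- The set `W(z)`. -/
def W (U : Set (Dd d)) (f : Dd d → Em m → Em m) (F : Em m → Kk k) (z : Kk k) :
    Set (Measure (Dd d × Em m)) :=
  {μ | IsProbabilityMeasure μ ∧ μ (U ×ˢ lvl F z) = 1 ∧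
    ∀ φ : Em m → ℝ, ContDiff ℝ 1 φ → ∫ p, fderiv ℝ φ p.2 (f p.1 p.2) ∂μ = 0}

/-- The metric `ρ` on probability measures: the Lévy–Prokhorov (extended) distance. -/
def ρ (μ ν : Measure (Dd d × Em m)) : ℝ≥0∞ := levyProkhorovEDist μ ν

/-- Distance from a measure to a set of measures, `ρ(μ, Γ) = inf_{ν ∈ Γ} ρ(μ,ν)`. -/
def ρpt (μ : Measure (Dd d × Em m)) (Γ : Set (Measure (Dd d × Em m))) : ℝ≥0∞ :=
  ⨅ ν ∈ Γ, ρ μ ν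

/-- The Hausdorff semimetric `ρ_H` on sets of measures. -/
def ρH (Γ₁ Γ₂ : Set (Measure (Dd d × Em m))) : ℝ≥0∞ :=
  max (⨆ μ ∈ Γ₁, ρpt μ Γ₂) (⨆ μ ∈ Γ₂, ρpt μ Γ₁)

/-- Continuity of the set-valued map `z ↦ W(z)` on `Z` with respect to `ρ_H`. -/
def WCont (U : Set (Dd d)) (f : Dd d → Em m → Em m) (F : Em m → Kk k)
    (Z : Set (Kk k)) : Prop :=
  ∀ z ∈ Z, ∀ δ : ℝ≥0∞, 0 < δ → ∃ ε > (0:ℝ), ∀ z' ∈ Z, ‖z' - z‖ < ε →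
    ρH (W U f F z') (W U f F z) < δ

/-- `h̃(μ) = ∫ h dμ`. -/
def htilde (F : Em m → Kk k) (g : Dd d → Em m → Em m) (μ : Measure (Dd d × Em m)) : Kk k :=
  ∫ p, hObs F g p ∂μ

/-- `r̃(μ) = ∫ r dμ`. -/
def rtilde (r : Dd d → Em m → ℝ) (μ : Measure (Dd d × Em m)) : ℝ :=
  ∫ p, r p.1 p.2 ∂μ

/-- The set-valued map `V(z) = {(h̃ μ, r̃ μ) : μ ∈ W(z)} ⊆ ℝ^{k+1}`. -/
def Vmap (U : Set (Dd d)) (f : Dd d → Em m → Em m) (F : Em m → Kk k)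
    (g : Dd d → Em m → Em m) (r : Dd d → Em m → ℝ) (z : Kk k) : Set (Kk k × ℝ) :=
  (fun μ => (htilde F g μ, rtilde r μ)) '' W U f F z

/-- Lipschitz continuity of `V` on `Z` in the Hausdorff metric. -/
def VLip (U : Set (Dd d)) (f : Dd d → Em m → Em m) (F : Em m → Kk k)
    (g : Dd d → Em m → Em m) (r : Dd d → Em m → ℝ) (Z : Set (Kk k)) : Prop :=
  ∃ L : ℝ, 0 ≤ L ∧ ∀ z' ∈ Z, ∀ z'' ∈ Z,
    hausdorffDist (Vmap U f F g r z') (Vmap U f F g r z'') ≤ L * ‖z' - z''‖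

/-- A solution `(μ(·), z(·))` of the averaged system with initial value `z₀`. -/
def IsAveragedSol (U : Set (Dd d)) (f : Dd d → Em m → Em m) (F : Em m → Kk k)
    (g : Dd d → Em m → Em m) (z₀ : Kk k)
    (μt : ℝ → Measure (Dd d × Em m)) (z : ℝ → Kk k) : Prop :=
  z 0 = z₀ ∧ ContinuousOn z (Ici 0) ∧
    (∀ T : ℝ, IntervalIntegrable (fun s => htilde F g (μt s)) volume 0 T) ∧
    (∀ t : ℝ, 0 ≤ t → z t = z₀ + ∫ s in (0:ℝ)..t, htilde F g (μt s)) ∧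
    (∀ t : ℝ, 0 ≤ t → μt t ∈ W U f F (z t))

/-- Viability of the averaged system in `Z`. -/
def AveragedViable (U : Set (Dd d)) (f : Dd d → Em m → Em m) (F : Em m → Kk k)
    (g : Dd d → Em m → Em m) (Z : Set (Kk k)) : Prop :=
  ∀ z₀ ∈ Z, ∃ μt zf, IsAveragedSol U f F g z₀ μt zf ∧ ∀ t : ℝ, 0 ≤ t → zf t ∈ Z

/-- Viability of the augmented perturbed system in `Y × Z`. -/
def AugViable (U : Set (Dd d)) (f g : Dd d → Em m → Em m) (F : Em m → Kk k)
    (Yset : Set (Em m)) (Z : Set (Kk k)) : Prop :=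
  ∀ ε > (0:ℝ), ∀ y₀ ∈ Yset, ∀ z₀ ∈ Z, ∃ u y zf,
    IsControl U u ∧ IsSolOn (fun s x => ε⁻¹ • f (u s) x + g (u s) x) y ∧ y 0 = y₀ ∧
    ContinuousOn zf (Ici 0) ∧ zf 0 = z₀ ∧
    (∀ T : ℝ, IntervalIntegrable (fun s => hObs F g (u s, y s)) volume 0 T) ∧
    (∀ t : ℝ, 0 ≤ t → zf t = z₀ + ∫ s in (0:ℝ)..t, hObs F g (u s, y s)) ∧
    (∀ t : ℝ, 0 ≤ t → y t ∈ Yset ∧ zf t ∈ Z)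

/-- The set `M_z(S, y₀)` of occupational measures on `[0,S]` of reduced solutions from `y₀`. -/
def Mz (U : Set (Dd d)) (f : Dd d → Em m → Em m) (S : ℝ) (y₀ : Em m) :
    Set (Measure (Dd d × Em m)) :=
  {μ | ∃ u y, IsControl U u ∧ IsSolOn (fun s x => f (u s) x) y ∧ y 0 = y₀ ∧ μ = occ u y S}

/-- Assumption 2 of the paper: `sup_{μ ∈ W(z)} ρ(μ, M_z(S,y₀)) ≤ β(S) → 0`,
uniformly over `y₀ ∈ Y_z` and `z ∈ Z`. -/
def Assumption2 (U : Set (Dd d)) (f : Dd d → Em m → Em m) (F : Em m → Kk k)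
    (Z : Set (Kk k)) : Prop :=
  ∃ β : ℝ → ℝ, Tendsto β atTop (𝓝 0) ∧
    ∀ z ∈ Z, ∀ y₀ ∈ lvl F z, ∀ S > (0:ℝ), ∀ μ ∈ W U f F z,
      ρpt μ (Mz U f S y₀) ≤ ENNReal.ofReal (β S)

/-- Optimal value `R^*(ε, y₀)` of the perturbed problem (shrinked time scale). -/
def Rstar (U : Set (Dd d)) (f g : Dd d → Em m → Em m) (r : Dd d → Em m → ℝ)
    (C : ℝ) (y₀ : Em m) (ε : ℝ) : ℝ :=
  sInf {v | ∃ u y, IsControl U u ∧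
    IsSolOn (fun s x => ε⁻¹ • f (u s) x + g (u s) x) y ∧ y 0 = y₀ ∧
    v = ∫ t in Ioi (0:ℝ), Real.exp (-C * t) * r (u t) (y t)}

/-- Optimal value `R̃^*` of the averaged problem. -/
def RtildeStar (U : Set (Dd d)) (f : Dd d → Em m → Em m) (F : Em m → Kk k)
    (g : Dd d → Em m → Em m) (r : Dd d → Em m → ℝ) (C : ℝ) (z₀ : Kk k) : ℝ :=
  sInf {v | ∃ μt z, IsAveragedSol U f F g z₀ μt z ∧
    v = ∫ t in Ioi (0:ℝ), Real.exp (-C * t) * rtilde r (μt t)}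

/-- Bilinear form `wᵀ Q v` of a matrix. -/
def matBil (Q : Matrix (Fin m) (Fin m) ℝ) (w v : Em m) : ℝ :=
  ∑ i, w i * Q.mulVec (fun j => v j) i

/-- The pair `(u(·), y(·))` generates the occupational measure `μ` on `[0,∞)`. -/
def GeneratesOM (u : ℝ → Dd d) (y : ℝ → Em m) (μ : Measure (Dd d × Em m)) : Prop :=
  IsProbabilityMeasure μ ∧ ∀ q : Dd d × Em m → ℝ, Continuous q →
    Tendsto (fun S : ℝ => S⁻¹ * ∫ τ in (0:ℝ)..S, q (u τ, y τ)) atTop (𝓝 (∫ p, q p ∂μ))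

/-- An average control generating (ACG) family `(u_z(·), y_z(·))` with occupational
measures `μ_z` and the (unique) solution `zsol` of `z'(t) = h̃(μ_{z(t)})`, `z 0 = z₀`. -/
def IsACG (U : Set (Dd d)) (f : Dd d → Em m → Em m) (F : Em m → Kk k)
    (g : Dd d → Em m → Em m) (Z : Set (Kk k)) (z₀ : Kk k)
    (uz : Kk k → ℝ → Dd d) (yz : Kk k → ℝ → Em m)
    (μz : Kk k → Measure (Dd d × Em m)) (zsol : ℝ → Kk k) : Prop :=
  (∀ z ∈ Z, IsControl U (uz z)) ∧
  (∀ z ∈ Z, IsSolOn (fun s x => f (uz z s) x) (yz z)) ∧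
  (∀ z ∈ Z, ∀ τ : ℝ, 0 ≤ τ → yz z τ ∈ lvl F z) ∧
  (∀ z ∈ Z, IsProbabilityMeasure (μz z)) ∧
  (∀ q : Dd d × Em m → ℝ, Continuous q →
    ∃ αq : ℝ → ℝ, Tendsto αq atTop (𝓝 0) ∧ ∀ z ∈ Z, ∀ S > (0:ℝ),
      |S⁻¹ * (∫ τ in (0:ℝ)..S, q (uz z τ, yz z τ)) - ∫ p, q p ∂(μz z)| ≤ αq S) ∧
  (∀ q : Dd d × Em m → ℝ, Continuous q → Measurable fun z => ∫ p, q p ∂(μz z)) ∧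
  zsol 0 = z₀ ∧ ContinuousOn zsol (Ici 0) ∧
  (∀ T : ℝ, IntervalIntegrable (fun s => htilde F g (μz (zsol s))) volume 0 T) ∧
  (∀ t : ℝ, 0 ≤ t → zsol t = z₀ + ∫ s in (0:ℝ)..t, htilde F g (μz (zsol s))) ∧
  (∀ t : ℝ, 0 ≤ t → zsol t ∈ Z) ∧
  (∀ w : ℝ → Kk k, w 0 = z₀ → ContinuousOn w (Ici 0) →
    (∀ T : ℝ, IntervalIntegrable (fun s => htilde F g (μz (w s))) volume 0 T) →
    (∀ t : ℝ, 0 ≤ t → w t = z₀ + ∫ s in (0:ℝ)..t, htilde F g (μz (w s))) →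
    (∀ t : ℝ, 0 ≤ t → w t ∈ Z) → ∀ t : ℝ, 0 ≤ t → w t = zsol t)

/-- Periodicity of an ACG family. -/
def ACGPeriodic (Z : Set (Kk k)) (uz : Kk k → ℝ → Dd d) (yz : Kk k → ℝ → Em m) : Prop :=
  ∀ z ∈ Z, ∃ T > (0:ℝ), ∀ τ : ℝ, 0 ≤ τ →
    uz z (τ + T) = uz z τ ∧ yz z (τ + T) = yz z τ

/-- Optimality of an ACG family in the averaged problem. -/
def ACGOptimal (U : Set (Dd d)) (f : Dd d → Em m → Em m) (F : Em m → Kk k)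
    (g : Dd d → Em m → Em m) (r : Dd d → Em m → ℝ) (C : ℝ) (z₀ : Kk k)
    (μz : Kk k → Measure (Dd d × Em m)) (zsol : ℝ → Kk k) : Prop :=
  (∫ t in Ioi (0:ℝ), Real.exp (-C * t) * rtilde r (μz (zsol t))) =
    RtildeStar U f F g r C z₀

/-- The set `D̃(z₀)` of discounted occupational measures supported on the graph of `W`. -/
def Dtilde (U : Set (Dd d)) (f : Dd d → Em m → Em m) (F : Em m → Kk k)
    (g : Dd d → Em m → Em m) (Z : Set (Kk k)) (C : ℝ) (z₀ : Kk k) :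
    Set (Measure (Measure (Dd d × Em m) × Kk k)) :=
  {p | IsProbabilityMeasure p ∧ p {q | q.2 ∈ Z ∧ q.1 ∈ W U f F q.2} = 1 ∧
    ∀ ψ : Kk k → ℝ, ContDiff ℝ 1 ψ →
      ∫ q, (fderiv ℝ ψ q.2 (htilde F g q.1) + C * (ψ z₀ - ψ q.2)) ∂p = 0}

/-- `ã^*(z₀)`: the optimal value of the IDLP problem. -/
def astar (U : Set (Dd d)) (f : Dd d → Em m → Em m) (F : Em m → Kk k)
    (g : Dd d → Em m → Em m) (r : Dd d → Em m → ℝ) (Z : Set (Kk k)) (C : ℝ)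
    (z₀ : Kk k) : ℝ :=
  sInf ((fun p => ∫ q, rtilde r q.1 ∂p) '' Dtilde U f F g Z C z₀)

/-- The Hamiltonian `H̃(p,z)` of the averaged system (`p` a linear functional). -/
def Htilde (U : Set (Dd d)) (f : Dd d → Em m → Em m) (F : Em m → Kk k)
    (g : Dd d → Em m → Em m) (r : Dd d → Em m → ℝ) (p : Kk k →L[ℝ] ℝ) (z : Kk k) : ℝ :=
  sInf ((fun μ => rtilde r μ + p (htilde F g μ)) '' W U f F z)

/-- Assumption V: existence of solutions `ζ*` of the averaged dual problem and `η*_z`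
of the associated dual problems. -/
def AssumptionV (U : Set (Dd d)) (f : Dd d → Em m → Em m) (F : Em m → Kk k)
    (g : Dd d → Em m → Em m) (r : Dd d → Em m → ℝ) (Z : Set (Kk k)) (C : ℝ)
    (z₀ : Kk k) (ζs : Kk k → ℝ) (ηs : Kk k → Em m → ℝ) : Prop :=
  ContDiff ℝ 1 ζs ∧ (∀ z, ContDiff ℝ 1 (ηs z)) ∧
  IsLeast ((fun z => Htilde U f F g r (fderiv ℝ ζs z) z + C * (ζs z₀ - ζs z)) '' Z)
    (astar U f F g r Z C z₀) ∧
  ∀ z ∈ Z, IsLeast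
    ((fun p : Dd d × Em m =>
        r p.1 p.2 + fderiv ℝ ζs z (hObs F g p) + fderiv ℝ (ηs z) p.2 (f p.1 p.2)) ''
      (U ×ˢ lvl F z))
    (Htilde U f F g r (fderiv ℝ ζs z) z)

/-- The occupational measure of a `T`-periodic orbit `y(·)` (a measure on the state space). -/
def perOcc (y : ℝ → Em m) (T : ℝ) : Measure (Em m) :=
  (ENNReal.ofReal T)⁻¹ • Measure.map y (volume.restrict (Ioc 0 T))

/-- Assumption III: for each `z ∈ Z`, the uncontrolled reduced system has a `T_z`-periodic
solution in `Y_z` (periods uniformly bounded), and every solution starting in `Y_z`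
is a time shift of it. -/
def AssumptionIII (f0 : Em m → Em m) (F : Em m → Kk k) (Z : Set (Kk k))
    (yper : Kk k → ℝ → Em m) (Tper : Kk k → ℝ) : Prop :=
  (∃ T₀ : ℝ, ∀ z ∈ Z, 0 < Tper z ∧ Tper z ≤ T₀) ∧
  (∀ z ∈ Z, IsSolOn (fun _ x => f0 x) (yper z)) ∧
  (∀ z ∈ Z, ∀ τ : ℝ, yper z τ ∈ lvl F z) ∧
  (∀ z ∈ Z, ∀ τ : ℝ, yper z (τ + Tper z) = yper z τ) ∧
  (∀ z ∈ Z, ∀ y : ℝ → Em m, IsSolOn (fun _ x => f0 x) y → y 0 ∈ lvl F z →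
    ∃ s : ℝ, ∀ τ : ℝ, 0 ≤ τ → y τ = yper z (τ + s))

/-- Assumption IV: existence, for each `z ∈ Z`, of a solution `ȳ_z` generating an
occupational measure `ν_z`, which asymptotically attracts (up to time shifts) every
solution staying in `Y_z`. -/
def AssumptionIV (f0 : Em m → Em m) (F : Em m → Kk k) (Z : Set (Kk k))
    (ybar : Kk k → ℝ → Em m) (ν : Kk k → Measure (Em m)) : Prop :=
  (∀ z ∈ Z, IsSolOn (fun _ x => f0 x) (ybar z)) ∧
  (∀ z ∈ Z, ∀ τ : ℝ, 0 ≤ τ → ybar z τ ∈ lvl F z) ∧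
  (∀ z ∈ Z, IsProbabilityMeasure (ν z) ∧ ν z (lvl F z) = 1) ∧
  (∀ q : Em m → ℝ, Continuous q → ∃ κ : ℝ → ℝ, Tendsto κ atTop (𝓝 0) ∧
    ∀ z ∈ Z, ∀ S > (0:ℝ),
      |S⁻¹ * (∫ τ in (0:ℝ)..S, q (ybar z τ)) - ∫ x, q x ∂(ν z)| ≤ κ S) ∧
  (∃ α₁ α₂ : ℝ → ℝ, Tendsto α₁ atTop (𝓝 0) ∧ Tendsto α₂ atTop (𝓝 0) ∧
    (∀ S > (0:ℝ), 0 < α₁ S ∧ 0 < α₂ S) ∧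
    ∀ z ∈ Z, ∀ y : ℝ → Em m, IsSolOn (fun _ x => f0 x) y →
      (∀ τ : ℝ, 0 ≤ τ → y τ ∈ lvl F z) → ∀ S > (0:ℝ),
        ∃ θ : ℝ, 0 ≤ θ ∧ θ / S ≤ α₂ S ∧
          ∀ τ ∈ Icc (0:ℝ) S, ‖y (τ + θ) - ybar z τ‖ ≤ α₁ S)

/-- Integral form of Grönwall's inequality on `[0, T]`. -/
lemma le_mul_exp_of_le_add_integral {φ : ℝ → ℝ} (hφ : Continuous φ) (h0 : ∀ t, 0 ≤ φ t)
    {a L T : ℝ} (hL : 0 ≤ L) (h : ∀ t ∈ Icc 0 T, φ t ≤ a + L * ∫ s in (0:ℝ)..t, φ s) :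
    ∀ t ∈ Icc 0 T, φ t ≤ a * Real.exp (L * t) := by
  intro t ht
  have hd : ∀ x, HasDerivAt (fun t => a + L * ∫ s in (0:ℝ)..t, φ s) (L * φ x) x := fun x =>
    ((intervalIntegral.integral_hasDerivAt_right (hφ.intervalIntegrable _ _)
      (hφ.stronglyMeasurableAtFilter _ _) hφ.continuousAt).const_mul L).const_add a
  have hpos : ∀ x ∈ Icc 0 T, 0 ≤ a + L * ∫ s in (0:ℝ)..x, φ s := fun x hx =>
    (h0 x).trans (h x hx)
  have key := norm_le_gronwallBound_of_norm_deriv_right_le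
    (f := fun t => a + L * ∫ s in (0:ℝ)..t, φ s) (f' := fun x => L * φ x) (δ := a) (K := L)
    (ε := 0) (a := 0) (b := T) (fun x _ => (hd x).continuousAt.continuousWithinAt)
    (fun x _ => (hd x).hasDerivWithinAt) (by
      have := hpos 0 ⟨le_rfl, ht.1.trans ht.2⟩
      simp only [intervalIntegral.integral_same, mul_zero, add_zero] at this ⊢
      rw [Real.norm_of_nonneg this]) (fun x hx => by
      have hx' : x ∈ Icc 0 T := ⟨hx.1, hx.2.le⟩
      rw [Real.norm_of_nonneg (mul_nonneg hL (h0 x)), Real.norm_of_nonneg (hpos x hx'), add_zero]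
      exact mul_le_mul_of_nonneg_left (h x hx') hL) t ht
  rw [gronwallBound_ε0, sub_zero, Real.norm_of_nonneg (hpos t ht)] at key
  exact (h t ht).trans key

/-- A measurable control with values in `U` at all times, together with a continuous
trajectory of the reduced system. -/
structure Traj (U : Set (Dd d)) (f : Dd d → Em m → Em m) (u : ℝ → Dd d) (w : ℝ → Em m) :
    Prop where
  meas : Measurable u
  mem : ∀ t, u t ∈ U
  cont : Continuous w
  eq : ∀ t, 0 ≤ t → w t = w 0 + ∫ s in (0:ℝ)..t, f (u s) (w s)

lemma intervalIntegrable_comp_control {X : Type*} [NormedAddCommGroup X]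
    [MeasurableSpace X] [BorelSpace X] [SecondCountableTopology X]
    {U : Set (Dd d)} (hU : IsCompact U) {G : Dd d × Em m → X} (hG : Continuous G)
    {u : ℝ → Dd d} {w : ℝ → Em m} (hu : Measurable u) (hmem : ∀ t, u t ∈ U)
    (hw : Continuous w) (a b : ℝ) :
    IntervalIntegrable (fun s => G (u s, w s)) volume a b := by
  have hK : IsCompact (U ×ˢ (w '' uIcc a b)) := hU.prod (isCompact_uIcc.image hw)
  obtain ⟨C, hC⟩ := hK.exists_bound_of_continuousOn hG.continuousOn
  have hm : Measurable fun s => G (u s, w s) := hG.measurable.comp (hu.prodMk hw.measurable)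
  rw [intervalIntegrable_iff]
  refine Measure.integrableOn_of_bounded (M := C) (by simp) hm.aestronglyMeasurable ?_
  filter_upwards [ae_restrict_mem measurableSet_uIoc] with s hs
  exact hC _ ⟨hmem s, mem_image_of_mem _ (uIoc_subset_uIcc hs)⟩

section
variable {U : Set (Dd d)} {f : Dd d → Em m → Em m} {u v : ℝ → Dd d} {w w' : ℝ → Em m}

lemma Traj.intervalIntegrable {X : Type*} [NormedAddCommGroup X]
    [MeasurableSpace X] [BorelSpace X] [SecondCountableTopology X]
    (h : Traj U f u w) (hU : IsCompact U) {G : Dd d × Em m → X} (hG : Continuous G) (a b : ℝ) :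
    IntervalIntegrable (fun s => G (u s, w s)) volume a b :=
  intervalIntegrable_comp_control hU hG h.meas h.mem h.cont a b

lemma Traj.norm_sub_le (h : Traj U f u w) (h' : Traj U f u w') (hU : IsCompact U)
    (hf : Continuous fun p : Dd d × Em m => f p.1 p.2) {L : ℝ≥0}
    (hL : ∀ v ∈ U, LipschitzWith L (f v)) {t : ℝ} (ht : 0 ≤ t) :
    ‖w t - w' t‖ ≤ ‖w 0 - w' 0‖ * Real.exp (L * t) := by
  refine le_mul_exp_of_le_add_integral (φ := fun t => ‖w t - w' t‖) (T := t)
    (h.cont.sub h'.cont).norm (fun _ => norm_nonneg _) L.2 ?_ t ⟨ht, le_rfl⟩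
  intro s hs
  have hi := h.intervalIntegrable hU hf 0 s
  have hi' := h'.intervalIntegrable hU hf 0 s
  have e : w s - w' s = (w 0 - w' 0) + ∫ r in (0:ℝ)..s, (f (u r) (w r) - f (u r) (w' r)) := by
    rw [intervalIntegral.integral_sub hi hi', h.eq s hs.1, h'.eq s hs.1]; abel
  rw [e]
  refine (norm_add_le _ _).trans (add_le_add le_rfl ?_)
  rw [← intervalIntegral.integral_const_mul]
  refine intervalIntegral.norm_integral_le_of_norm_le hs.1 ?_
    (((h.cont.sub h'.cont).norm.const_mul _).intervalIntegrable _ _)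
  refine Eventually.of_forall fun r _ => ?_
  simpa [dist_eq_norm] using (hL _ (h.mem r)).dist_le_mul (w r) (w' r)

lemma Traj.norm_sub_zero_le (h : Traj U f u w) {L : ℝ≥0}
    (hL : ∀ v ∈ U, LipschitzWith L (f v)) {B T : ℝ} (hB : ∀ v ∈ U, ‖f v (w 0)‖ ≤ B)
    {t : ℝ} (ht : t ∈ Icc 0 T) :
    ‖w t - w 0‖ ≤ B * T * Real.exp (L * T) := by
  have hB0 : 0 ≤ B := (norm_nonneg _).trans (hB _ (h.mem 0))
  have hT : 0 ≤ T := ht.1.trans ht.2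
  have key := le_mul_exp_of_le_add_integral (φ := fun t => ‖w t - w 0‖) (T := T) (a := B * T)
    (L := L) (h.cont.sub continuous_const).norm (fun _ => norm_nonneg _) L.2 ?_ t ht
  · refine key.trans (mul_le_mul_of_nonneg_left ?_ (mul_nonneg hB0 hT))
    exact Real.exp_le_exp.2 (mul_le_mul_of_nonneg_left ht.2 L.2)
  intro s hs
  have hc : Continuous fun r => ‖w r - w 0‖ := (h.cont.sub continuous_const).norm
  have e : w s - w 0 = ∫ r in (0:ℝ)..s, f (u r) (w r) := by
    rw [h.eq s hs.1]; abel
  have : ‖w s - w 0‖ ≤ ∫ r in (0:ℝ)..s, (B + L * ‖w r - w 0‖) := by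
    rw [e]
    refine intervalIntegral.norm_integral_le_of_norm_le hs.1 ?_
      ((continuous_const.add (hc.const_mul _)).intervalIntegrable _ _)
    refine Eventually.of_forall fun r _ => ?_
    have h1 := (hL _ (h.mem r)).dist_le_mul (w r) (w 0)
    rw [dist_eq_norm, dist_eq_norm] at h1
    have h2 := hB _ (h.mem r)
    have h3 := norm_sub_norm_le (f (u r) (w r)) (f (u r) (w 0))
    linarith
  rw [intervalIntegral.integral_add (by simp) ((hc.const_mul _).intervalIntegrable _ _),
    intervalIntegral.integral_const_mul] at this
  refine this.trans (add_le_add ?_ le_rfl)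
  simp only [intervalIntegral.integral_const, sub_zero, smul_eq_mul]
  rw [mul_comm]
  exact mul_le_mul_of_nonneg_left hs.2 hB0

/-- Global existence of Carathéodory trajectories. -/
lemma exists_traj (hU : IsCompact U)
    (hf : Continuous fun p : Dd d × Em m => f p.1 p.2) {L : ℝ≥0}
    (hL : ∀ v ∈ U, LipschitzWith L (f v)) (hu : Measurable u) (hmem : ∀ t, u t ∈ U) (x : Em m) :
    ∃ w, Traj U f u w ∧ w 0 = x := by
  set l : ℝ := L + 1 with hl
  have hl0 : 0 < l := by positivity
  obtain ⟨C0, hC0⟩ := hU.exists_bound_of_continuousOn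
    (f := fun v => f v 0) (by fun_prop : Continuous fun v => f v 0).continuousOn
  have hC00 : 0 ≤ C0 := (norm_nonneg _).trans (hC0 _ (hmem 0))
  have hexp : ∀ τ : ℝ, ∫ s in (0:ℝ)..τ, Real.exp (l * s) ≤ Real.exp (l * τ) / l := by
    intro τ
    have : ∀ s ∈ uIcc 0 τ, HasDerivAt (fun s => Real.exp (l * s) / l) (Real.exp (l * s)) s := by
      intro s _
      have := (((hasDerivAt_id s).const_mul l).exp).div_const l
      rwa [mul_one, mul_div_cancel_right₀ _ hl0.ne'] at this
    rw [intervalIntegral.integral_eq_sub_of_hasDerivAt this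
      ((by fun_prop : Continuous fun s => Real.exp (l * s)).intervalIntegrable _ _)]
    have : 0 ≤ Real.exp (l * 0) / l := by positivity
    linarith
  have hii : ∀ φ : BoundedContinuousFunction ℝ (Em m), ∀ a b : ℝ,
      IntervalIntegrable (fun s => f (u s) (Real.exp (l * s) • φ s)) volume a b := fun φ a b =>
    intervalIntegrable_comp_control hU hf hu hmem (w := fun s => Real.exp (l * s) • φ s)
      (by have := φ.continuous; fun_prop) a b
  have hce : Continuous fun s => Real.exp (l * s) := by fun_prop
  have hcont : ∀ φ : BoundedContinuousFunction ℝ (Em m), Continuous fun t : ℝ =>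
      Real.exp (-(l * max t 0)) •
        (x + ∫ s in (0:ℝ)..max t 0, f (u s) (Real.exp (l * s) • φ s)) := by
    intro φ
    have h1 : Continuous fun t : ℝ => ∫ s in (0:ℝ)..t, f (u s) (Real.exp (l * s) • φ s) :=
      intervalIntegral.continuous_primitive (fun a b => hii φ a b) 0
    have h2 : Continuous fun t : ℝ => max t 0 := by fun_prop
    have h3 := h1.comp h2
    have h4 : Continuous fun t : ℝ => Real.exp (-(l * max t 0)) := by fun_prop
    exact h4.smul (continuous_const.add h3)
  have hbd : ∀ φ : BoundedContinuousFunction ℝ (Em m), ∀ t : ℝ,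
      ‖Real.exp (-(l * max t 0)) •
        (x + ∫ s in (0:ℝ)..max t 0, f (u s) (Real.exp (l * s) • φ s))‖ ≤
        ‖x‖ + (C0 + L * ‖φ‖) / l := by
    intro φ t
    set τ := max t 0
    have hτ : 0 ≤ τ := le_max_right _ _
    have h1 : ‖∫ s in (0:ℝ)..τ, f (u s) (Real.exp (l * s) • φ s)‖ ≤
        ∫ s in (0:ℝ)..τ, (C0 + L * ‖φ‖) * Real.exp (l * s) := by
      refine intervalIntegral.norm_integral_le_of_norm_le hτ ?_
        ((hce.const_mul _).intervalIntegrable _ _)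
      refine Eventually.of_forall fun s hs => ?_
      have h1 := (hL _ (hmem s)).dist_le_mul (Real.exp (l * s) • φ s) 0
      rw [dist_eq_norm, dist_zero_right, norm_smul, Real.norm_of_nonneg (Real.exp_pos _).le] at h1
      have h2 := hC0 _ (hmem s)
      have h3 := norm_sub_norm_le (f (u s) (Real.exp (l * s) • φ s)) (f (u s) 0)
      have h4 := φ.norm_coe_le_norm s
      have h5 : 1 ≤ Real.exp (l * s) := Real.one_le_exp (mul_nonneg hl0.le hs.1.le)
      have h6 : (L:ℝ) * (Real.exp (l * s) * ‖φ s‖) ≤ L * (Real.exp (l * s) * ‖φ‖) := by gcongr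
      nlinarith
    rw [intervalIntegral.integral_const_mul] at h1
    have hK : 0 ≤ C0 + L * ‖φ‖ := by positivity
    have h2 := h1.trans (mul_le_mul_of_nonneg_left (hexp τ) hK)
    rw [norm_smul, Real.norm_of_nonneg (Real.exp_pos _).le]
    have h3 : Real.exp (-(l * τ)) ≤ 1 := Real.exp_le_one_iff.2 (by nlinarith)
    have h4 : Real.exp (-(l * τ)) * Real.exp (l * τ) = 1 := by rw [← Real.exp_add]; simp
    calc _ ≤ Real.exp (-(l * τ)) * (‖x‖ + (C0 + L * ‖φ‖) * (Real.exp (l * τ) / l)) := by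
          gcongr
          exact (norm_add_le _ _).trans (add_le_add le_rfl h2)
      _ = Real.exp (-(l * τ)) * ‖x‖ +
          (C0 + L * ‖φ‖) / l * (Real.exp (-(l * τ)) * Real.exp (l * τ)) := by ring
      _ ≤ ‖x‖ + (C0 + L * ‖φ‖) / l := by
          rw [h4, mul_one]
          have := mul_le_mul_of_nonneg_right h3 (norm_nonneg x)
          linarith
  let Φ : BoundedContinuousFunction ℝ (Em m) → BoundedContinuousFunction ℝ (Em m) := fun φ =>
    BoundedContinuousFunction.ofNormedAddCommGroup _ (hcont φ) _ (hbd φ)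
  have hΦ : ContractingWith (L / (L + 1)) Φ := by
    refine ⟨?_, LipschitzWith.of_dist_le_mul fun φ ψ => ?_⟩
    · rw [div_lt_one (by positivity)]; exact lt_add_one L
    refine (BoundedContinuousFunction.dist_le (by positivity)).2 fun t => ?_
    simp only [Φ, BoundedContinuousFunction.coe_ofNormedAddCommGroup]
    set τ := max t 0
    have hτ : 0 ≤ τ := le_max_right _ _
    rw [dist_eq_norm, ← smul_sub, add_sub_add_left_eq_sub,
      ← intervalIntegral.integral_sub (hii φ _ _) (hii ψ _ _), norm_smul,
      Real.norm_of_nonneg (Real.exp_pos _).le]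
    have h1 : ‖∫ s in (0:ℝ)..τ, (f (u s) (Real.exp (l * s) • φ s) -
        f (u s) (Real.exp (l * s) • ψ s))‖ ≤
        ∫ s in (0:ℝ)..τ, (L * dist φ ψ) * Real.exp (l * s) := by
      refine intervalIntegral.norm_integral_le_of_norm_le hτ ?_
        ((hce.const_mul _).intervalIntegrable _ _)
      refine Eventually.of_forall fun s hs => ?_
      have h1 := (hL _ (hmem s)).dist_le_mul (Real.exp (l * s) • φ s) (Real.exp (l * s) • ψ s)
      rw [dist_smul₀, Real.norm_of_nonneg (Real.exp_pos _).le, dist_eq_norm] at h1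
      have h4 := BoundedContinuousFunction.dist_coe_le_dist (f := φ) (g := ψ) s
      have : (L:ℝ) * (Real.exp (l * s) * dist (φ s) (ψ s)) ≤
        L * (Real.exp (l * s) * dist φ ψ) := by gcongr
      linarith
    rw [intervalIntegral.integral_const_mul] at h1
    have h2 := h1.trans (mul_le_mul_of_nonneg_left (hexp τ) (by positivity))
    have h4 : Real.exp (-(l * τ)) * Real.exp (l * τ) = 1 := by rw [← Real.exp_add]; simp
    calc _ ≤ Real.exp (-(l * τ)) * (L * dist φ ψ * (Real.exp (l * τ) / l)) := by gcongr
      _ = L / l * dist φ ψ * (Real.exp (-(l * τ)) * Real.exp (l * τ)) := by ring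
      _ = _ := by rw [h4, hl]; simp
  set φ := ContractingWith.fixedPoint Φ hΦ
  have hfix : Φ φ = φ := hΦ.fixedPoint_isFixedPt
  have hφ : ∀ t, 0 ≤ t → Real.exp (l * t) • φ t =
      x + ∫ s in (0:ℝ)..t, f (u s) (Real.exp (l * s) • φ s) := by
    intro t ht
    have h1 : φ t = Real.exp (-(l * max t 0)) •
        (x + ∫ s in (0:ℝ)..max t 0, f (u s) (Real.exp (l * s) • φ s)) :=
      (DFunLike.congr_fun hfix t).symm
    rw [max_eq_left ht] at h1
    nth_rewrite 1 [h1]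
    rw [smul_smul, ← Real.exp_add]
    simp
  have h0 : Real.exp (l * 0) • φ 0 = x := by rw [hφ 0 le_rfl]; simp
  refine ⟨fun t => Real.exp (l * t) • φ t, ⟨hu, hmem, ?_, ?_⟩, h0⟩
  · have := φ.continuous; fun_prop
  · intro t ht
    rw [h0]
    exact hφ t ht

end

section
variable {U : Set (Dd d)} {f : Dd d → Em m → Em m} {u v : ℝ → Dd d} {w w' : ℝ → Em m}

/-- Concatenation of two trajectories at time `τ`. -/
lemma Traj.concat (h : Traj U f u w) (h' : Traj U f v w') (hU : IsCompact U)
    (hf : Continuous fun p : Dd d × Em m => f p.1 p.2) {τ : ℝ} (hτ : 0 ≤ τ) (h0 : w' 0 = w τ) :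
    ∃ uc wc, Traj U f uc wc ∧ (∀ t ≤ τ, uc t = u t ∧ wc t = w t) ∧
      (∀ t, 0 < t → uc (τ + t) = v t) ∧ (∀ t, 0 ≤ t → wc (τ + t) = w' t) := by
  set uc : ℝ → Dd d := fun t => if t ≤ τ then u t else v (t - τ) with huc
  set wc : ℝ → Em m := fun t => if t ≤ τ then w t else w' (t - τ) with hwc
  have hm : Measurable uc :=
    Measurable.ite measurableSet_Iic h.meas (h'.meas.comp (measurable_id.sub_const τ))
  have hmem : ∀ t, uc t ∈ U := fun t => by
    simp only [huc]; split_ifs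
    exacts [h.mem _, h'.mem _]
  have hcont : Continuous wc := by
    refine Continuous.if_le h.cont (h'.cont.comp (continuous_id.sub continuous_const))
      continuous_id continuous_const ?_
    rintro t rfl
    simp [h0]
  have hA : ∀ t ≤ τ, uc t = u t ∧ wc t = w t := fun t ht => by simp [huc, hwc, ht]
  have hB : ∀ t, 0 < t → uc (τ + t) = v t := fun t ht => by
    simp [huc, not_le.2 ht]
  have hC : ∀ t, 0 ≤ t → wc (τ + t) = w' t := fun t ht => by
    rcases ht.eq_or_lt with rfl | ht
    · simp [hwc, h0]
    · simp [hwc, not_le.2 ht]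
  refine ⟨uc, wc, ⟨hm, hmem, hcont, ?_⟩, hA, hB, hC⟩
  have hle : ∀ t, 0 ≤ t → t ≤ τ → wc t = wc 0 + ∫ s in (0:ℝ)..t, f (uc s) (wc s) := by
    intro t ht htτ
    rw [(hA t htτ).2, (hA 0 hτ).2, h.eq t ht]
    congr 1
    refine intervalIntegral.integral_congr fun s hs => ?_
    rw [uIcc_of_le ht] at hs
    simp only [hA s (hs.2.trans htτ)]
  intro t ht
  rcases le_total t τ with htτ | htτ
  · exact hle t ht htτ
  obtain ⟨r, rfl⟩ : ∃ r, t = τ + r := ⟨t - τ, by ring⟩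
  have hr : 0 ≤ r := by linarith
  rw [hC r hr, h'.eq r hr, h0, ← (hA τ le_rfl).2, hle τ hτ le_rfl, add_assoc]
  congr 1
  have hi := fun a b => intervalIntegrable_comp_control hU hf hm hmem hcont a b
  rw [← intervalIntegral.integral_add_adjacent_intervals (hi 0 τ) (hi τ (τ + r))]
  congr 1
  have := intervalIntegral.integral_comp_add_left (a := 0) (b := r)
    (fun s => f (uc s) (wc s)) τ
  rw [add_zero] at this
  rw [← this]
  refine intervalIntegral.integral_congr_ae (Eventually.of_forall fun s hs => ?_)
  rw [uIoc_of_le hr] at hs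
  simp only [hB s hs.1, hC s hs.1.le]

lemma integral_eq_add_of_concat {G : Dd d × Em m → ℝ} (hG : Continuous G)
    (hU : IsCompact U) {uc : ℝ → Dd d} {wc : ℝ → Em m} {τ r : ℝ} (hτ : 0 ≤ τ) (hr : 0 ≤ r)
    (hc : Traj U f uc wc)
    (hA : ∀ t ≤ τ, uc t = u t ∧ wc t = w t) (hB : ∀ t, 0 < t → uc (τ + t) = v t)
    (hC : ∀ t, 0 ≤ t → wc (τ + t) = w' t) :
    ∫ s in (0:ℝ)..(τ + r), G (uc s, wc s) =
      (∫ s in (0:ℝ)..τ, G (u s, w s)) + ∫ s in (0:ℝ)..r, G (v s, w' s) := by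
  have hi := fun a b => hc.intervalIntegrable hU hG a b
  rw [← intervalIntegral.integral_add_adjacent_intervals (hi 0 τ) (hi τ (τ + r))]
  congr 1
  · refine intervalIntegral.integral_congr fun s hs => ?_
    rw [uIcc_of_le hτ] at hs
    simp only [hA s hs.2]
  · have := intervalIntegral.integral_comp_add_left (a := 0) (b := r)
      (fun s => G (uc s, wc s)) τ
    rw [add_zero] at this
    rw [← this]
    refine intervalIntegral.integral_congr_ae (Eventually.of_forall fun s hs => ?_)
    rw [uIoc_of_le hr] at hs
    simp only [hB s hs.1, hC s hs.1.le]

lemma Traj.isControl (h : Traj U f u w) : IsControl U u := ⟨h.meas, fun t _ => h.mem t⟩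

lemma Traj.isSolOn (h : Traj U f u w) (hU : IsCompact U)
    (hf : Continuous fun p : Dd d × Em m => f p.1 p.2) : IsSolOn (fun s x => f (u s) x) w :=
  ⟨h.cont.continuousOn, fun T => h.intervalIntegrable hU hf 0 T, h.eq⟩

/-- Freezing a control and its trajectory at negative times. -/
lemma exists_traj_of_isSolOn (hu : IsControl U u) (hw : IsSolOn (fun s x => f (u s) x) w) :
    ∃ u' w', Traj U f u' w' ∧ ∀ t, 0 ≤ t → w' t = w t := by
  have hmax : ∀ t : ℝ, 0 ≤ t → max t 0 = t := fun t ht => max_eq_left ht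
  refine ⟨fun t => u (max t 0), fun t => w (max t 0), ⟨?_, ?_, ?_, ?_⟩, fun t ht => by
    simp only [hmax t ht]⟩
  · exact hu.1.comp (measurable_id.max measurable_const)
  · exact fun t => hu.2 _ (le_max_right _ _)
  · exact hw.1.comp_continuous (by fun_prop) fun t => mem_Ici.2 (le_max_right _ _)
  · intro t ht
    simp only [hmax t ht, max_self]
    rw [hw.2.2 t ht]
    congr 1
    refine intervalIntegral.integral_congr fun s hs => ?_
    rw [uIcc_of_le ht] at hs
    simp only [hmax s hs.1]

end

section ValueFunction

/-- The cost of a trajectory over `[0, T]` with running cost `q` and terminal cost `V0`. -/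
def cost (q : Dd d × Em m → ℝ) (V0 : Em m → ℝ) (T : ℝ) (u : ℝ → Dd d) (w : ℝ → Em m) : ℝ :=
  (∫ s in (0:ℝ)..T, q (u s, w s)) + V0 (w T)

/-- The value function of the optimal control problem over `[0, T]` started at `x`. -/
def val (U : Set (Dd d)) (f : Dd d → Em m → Em m) (q : Dd d × Em m → ℝ) (V0 : Em m → ℝ)
    (T : ℝ) (x : Em m) : ℝ :=
  sInf {c | ∃ u w, Traj U f u w ∧ w 0 = x ∧ c = cost q V0 T u w}

variable {U : Set (Dd d)} {f : Dd d → Em m → Em m} {q : Dd d × Em m → ℝ} {V0 : Em m → ℝ}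
  {B T : ℝ} {x x' : Em m} {L Lq M : ℝ≥0}

lemma neg_le_cost (hB : ∀ p, |q p| ≤ B) (h0 : ∀ y, 0 ≤ V0 y) (hT : 0 ≤ T)
    (u : ℝ → Dd d) (w : ℝ → Em m) : -(B * T) ≤ cost q V0 T u w := by
  have h1 : ‖∫ s in (0:ℝ)..T, q (u s, w s)‖ ≤ B * |T - 0| :=
    intervalIntegral.norm_integral_le_of_norm_le_const fun s _ => hB _
  rw [sub_zero, abs_of_nonneg hT, Real.norm_eq_abs] at h1
  have := neg_le_of_abs_le h1
  have := h0 (w T)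
  unfold cost
  linarith

lemma val_le_cost (hB : ∀ p, |q p| ≤ B) (h0 : ∀ y, 0 ≤ V0 y) (hT : 0 ≤ T)
    {u : ℝ → Dd d} {w : ℝ → Em m} (h : Traj U f u w) :
    val U f q V0 T (w 0) ≤ cost q V0 T u w :=
  csInf_le ⟨-(B * T), by rintro _ ⟨u, w, -, -, rfl⟩; exact neg_le_cost hB h0 hT u w⟩
    ⟨u, w, h, rfl, rfl⟩

lemma exists_cost_lt (hU : IsCompact U) (hne : U.Nonempty)
    (hf : Continuous fun p : Dd d × Em m => f p.1 p.2) (hL : ∀ v ∈ U, LipschitzWith L (f v))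
    (q : Dd d × Em m → ℝ) (V0 : Em m → ℝ) (T : ℝ) (x : Em m) {ε : ℝ} (hε : 0 < ε) :
    ∃ u w, Traj U f u w ∧ w 0 = x ∧ cost q V0 T u w < val U f q V0 T x + ε := by
  obtain ⟨u0, hu0⟩ := hne
  obtain ⟨w, hw, hx⟩ := exists_traj hU hf hL (u := fun _ => u0) measurable_const
    (fun _ => hu0) x
  obtain ⟨_, ⟨u, w, h, hx, rfl⟩, hlt⟩ := exists_lt_of_csInf_lt
    (s := {c | ∃ u w, Traj U f u w ∧ w 0 = x ∧ c = cost q V0 T u w})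
    ⟨_, _, _, hw, hx, rfl⟩ (lt_add_of_pos_right (val U f q V0 T x) hε)
  exact ⟨u, w, h, hx, hlt⟩

lemma val_zero (hU : IsCompact U) (hne : U.Nonempty)
    (hf : Continuous fun p : Dd d × Em m => f p.1 p.2) (hL : ∀ v ∈ U, LipschitzWith L (f v))
    (q : Dd d × Em m → ℝ) (V0 : Em m → ℝ) (x : Em m) :
    val U f q V0 0 x = V0 x := by
  have : {c | ∃ u w, Traj U f u w ∧ w 0 = x ∧ c = cost q V0 0 u w} = {V0 x} := by
    ext c
    constructor
    · rintro ⟨u, w, -, hx, rfl⟩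
      simp [cost, hx]
    · rintro rfl
      obtain ⟨u, w, h, hx, -⟩ := exists_cost_lt hU hne hf hL q V0 0 x one_pos
      exact ⟨u, w, h, hx, by simp [cost, hx]⟩
  rw [val, this, csInf_singleton]

/-- Uniform closeness of the running costs along two trajectories with the same control. -/
lemma integral_sub_le (hU : IsCompact U)
    (hf : Continuous fun p : Dd d × Em m => f p.1 p.2) (hL : ∀ v ∈ U, LipschitzWith L (f v))
    (hq : Continuous q) (hqL : ∀ v ∈ U, LipschitzWith Lq fun y => q (v, y))
    {u : ℝ → Dd d} {w w' : ℝ → Em m} (h : Traj U f u w) (h' : Traj U f u w') {a b : ℝ}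
    (ha : 0 ≤ a) (hab : a ≤ b) :
    |(∫ s in a..b, q (u s, w s)) - ∫ s in a..b, q (u s, w' s)| ≤
      Lq * (‖w 0 - w' 0‖ * Real.exp (L * b)) * (b - a) := by
  rw [← intervalIntegral.integral_sub (h.intervalIntegrable hU hq _ _)
    (h'.intervalIntegrable hU hq _ _), ← Real.norm_eq_abs]
  refine (intervalIntegral.norm_integral_le_of_norm_le_const fun s hs => ?_).trans_eq
    (by rw [abs_of_nonneg (sub_nonneg.2 hab)])
  rw [uIoc_of_le hab] at hs
  have h1 := (hqL _ (h.mem s)).dist_le_mul (w s) (w' s)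
  rw [dist_eq_norm, dist_eq_norm] at h1
  refine h1.trans ?_
  gcongr
  refine (h.norm_sub_le h' hU hf hL (ha.trans hs.1.le)).trans ?_
  have := hs.2
  gcongr

lemma lipschitzWith_val (hU : IsCompact U) (hne : U.Nonempty)
    (hf : Continuous fun p : Dd d × Em m => f p.1 p.2) (hL : ∀ v ∈ U, LipschitzWith L (f v))
    (hq : Continuous q) (hB : ∀ p, |q p| ≤ B) (hqL : ∀ v ∈ U, LipschitzWith Lq fun y => q (v, y))
    (h0 : ∀ y, 0 ≤ V0 y) (hV0 : LipschitzWith M V0) {N : ℝ≥0} (hT : 0 ≤ T) (hTN : T ≤ N) :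
    LipschitzWith ((Lq * N + M) * (Real.exp (L * N)).toNNReal) (val U f q V0 T) := by
  refine LipschitzWith.of_le_add_mul _ fun x x' => ?_
  refine le_of_forall_pos_le_add fun ε hε => ?_
  obtain ⟨u, w', h', rfl, hlt⟩ := exists_cost_lt hU hne hf hL q V0 T x' hε
  obtain ⟨w, h, rfl⟩ := exists_traj hU hf hL h'.meas h'.mem x
  have h1 := val_le_cost hB h0 hT h
  have h2 := integral_sub_le hU hf hL hq hqL h h' le_rfl hT
  have h3 := hV0.dist_le_mul (w T) (w' T)
  have h4 := h.norm_sub_le h' hU hf hL hT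
  rw [dist_eq_norm, dist_eq_norm] at h3
  have h5 := (le_abs_self _).trans h2
  have h6 := (le_abs_self _).trans h3
  unfold cost at h1 hlt
  push_cast
  rw [Real.coe_toNNReal _ (Real.exp_pos _).le, dist_eq_norm]
  have h7 : Real.exp (L * T) ≤ Real.exp (L * N) := by gcongr
  have h8 : (Lq:ℝ) * (‖w 0 - w' 0‖ * Real.exp (L * T)) * (T - 0) ≤
      Lq * (‖w 0 - w' 0‖ * Real.exp (L * N)) * N := by
    rw [sub_zero]; gcongr
  have h9 : (M:ℝ) * ‖w T - w' T‖ ≤ M * (‖w 0 - w' 0‖ * Real.exp (L * N)) := by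
    refine mul_le_mul_of_nonneg_left (h4.trans ?_) M.2
    gcongr
  nlinarith

/-- One step of the dynamic programming inequality, with Euler's approximation of the motion. -/
lemma val_add_le (hU : IsCompact U)
    (hne : U.Nonempty)
    (hf : Continuous fun p : Dd d × Em m => f p.1 p.2) (hL : ∀ v ∈ U, LipschitzWith L (f v))
    (hq : Continuous q) (hB : ∀ p, |q p| ≤ B) (hqL : ∀ v ∈ U, LipschitzWith Lq fun y => q (v, y))
    (h0 : ∀ y, 0 ≤ V0 y) {Λ : ℝ≥0} (hT : 0 ≤ T) (hΛ : LipschitzWith Λ (val U f q V0 T))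
    {Bf h : ℝ} (hh : 0 ≤ h) (hh1 : h ≤ 1) (hBf : ∀ v ∈ U, ‖f v x‖ ≤ Bf) {v : Dd d} (hv : v ∈ U) :
    val U f q V0 (h + T) x ≤ h * q (v, x) + val U f q V0 T (x + h • f v x) +
      (Lq + Λ * L) * (Bf * Real.exp L) * h ^ 2 := by
  have hBf0 : 0 ≤ Bf := (norm_nonneg _).trans (hBf _ hv)
  obtain ⟨w, hw, rfl⟩ := exists_traj hU hf hL (u := fun _ => v) measurable_const (fun _ => hv) x
  have hclose : ∀ s ∈ Icc 0 h, ‖w s - w 0‖ ≤ Bf * h * Real.exp L := fun s hs => by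
    refine (hw.norm_sub_zero_le hL hBf hs).trans ?_
    have : (L:ℝ) * h ≤ L := mul_le_of_le_one_right L.2 hh1
    gcongr
  refine le_of_forall_pos_le_add fun ε hε => ?_
  obtain ⟨u', w', hw', hw'0, hlt⟩ := exists_cost_lt hU hne hf hL q V0 T (w h) hε
  obtain ⟨uc, wc, hc, hA, hB', hC⟩ := hw.concat hw' hU hf hh hw'0
  have h1 := val_le_cost hB h0 (add_nonneg hh hT) hc
  rw [(hA 0 hh).2] at h1
  have h2 : cost q V0 (h + T) uc wc = (∫ s in (0:ℝ)..h, q (v, w s)) + cost q V0 T u' w' := by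
    unfold cost
    rw [integral_eq_add_of_concat hq hU hh hT hc hA hB' hC, hC T hT, add_assoc]
  have h3 : (∫ s in (0:ℝ)..h, q (v, w s)) ≤ h * q (v, w 0) + Lq * (Bf * h * Real.exp L) * h := by
    have hi : IntervalIntegrable (fun s => q (v, w s)) volume 0 h :=
      hw.intervalIntegrable hU hq 0 h
    calc (∫ s in (0:ℝ)..h, q (v, w s)) ≤
        ∫ s in (0:ℝ)..h, (q (v, w 0) + Lq * (Bf * h * Real.exp L)) := by
          refine intervalIntegral.integral_mono_on hh hi (by simp) fun s hs => ?_
          have h1 := (hqL _ hv).dist_le_mul (w s) (w 0)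
          rw [dist_eq_norm, dist_eq_norm] at h1
          have h2 := (le_abs_self _).trans h1
          have := mul_le_mul_of_nonneg_left (hclose s hs) Lq.2
          simp only [NNReal.val_eq_coe] at this
          linarith
      _ = _ := by simp; ring
  have h4 : ‖w h - (w 0 + h • f v (w 0))‖ ≤ L * (Bf * h * Real.exp L) * h := by
    have hi : IntervalIntegrable (fun s => f v (w s)) volume 0 h :=
      hw.intervalIntegrable hU hf 0 h
    have e : w h - (w 0 + h • f v (w 0)) = ∫ s in (0:ℝ)..h, (f v (w s) - f v (w 0)) := by
      rw [intervalIntegral.integral_sub hi (by simp), intervalIntegral.integral_const, sub_zero,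
        hw.eq h hh]
      abel
    rw [e]
    refine (intervalIntegral.norm_integral_le_of_norm_le_const fun s hs => ?_).trans_eq
      (by rw [sub_zero, abs_of_nonneg hh])
    rw [uIoc_of_le hh] at hs
    have h1 := (hL _ hv).dist_le_mul (w s) (w 0)
    rw [dist_eq_norm, dist_eq_norm] at h1
    exact h1.trans (mul_le_mul_of_nonneg_left (hclose s ⟨hs.1.le, hs.2⟩) L.2)
  have h5 := hΛ.dist_le_mul (w h) (w 0 + h • f v (w 0))
  rw [dist_eq_norm, dist_eq_norm] at h5
  have h6 := (le_abs_self _).trans h5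
  have h7 := mul_le_mul_of_nonneg_left h4 Λ.2
  simp only [NNReal.val_eq_coe] at h7
  nlinarith

end ValueFunction

/-- A compactly supported smoothing kernel concentrated on a small ball, together with a
second-order Taylor bound for regularized Lipschitz functions. -/
lemma exists_mollifier (m : ℕ) {s : ℝ} (hs : 0 < s) :
    ∃ η : Em m → ℝ, Continuous η ∧ HasCompactSupport η ∧ (∀ w, 0 ≤ η w) ∧ ∫ w, η w = 1 ∧
      (∀ w, s ≤ ‖w‖ → η w = 0) ∧
      ∃ A : ℝ, 0 ≤ A ∧ ∀ (Λ : ℝ≥0) (φ : Em m → ℝ), LipschitzWith Λ φ →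
        ContDiff ℝ 1 (fun x => ∫ w, η w * φ (x - w)) ∧
        ∀ x v, |(∫ w, η w * φ (x + v - w)) - (∫ w, η w * φ (x - w)) -
          fderiv ℝ (fun x => ∫ w, η w * φ (x - w)) x v| ≤ Λ * A * ‖v‖ ^ 2 := by
  let b : ContDiffBump (0 : Em m) := ⟨s / 2, s, by positivity, by linarith⟩
  set η : Em m → ℝ := b.normed volume with hη
  have hηc : HasCompactSupport η := b.hasCompactSupport_normed
  have hηd : ContDiff ℝ 1 η := b.contDiff_normed (n := 1)
  have hdc : Continuous (fderiv ℝ η) := hηd.continuous_fderiv one_ne_zero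
  have hds : HasCompactSupport (fderiv ℝ η) := hηc.fderiv ℝ
  have hdi : Integrable (fun t => ‖fderiv ℝ η t‖) :=
    (hdc.integrable_of_hasCompactSupport hds).norm
  refine ⟨η, b.continuous_normed, hηc, b.nonneg_normed, b.integral_normed, fun w hw => ?_,
    ∫ t, ‖fderiv ℝ η t‖, integral_nonneg fun _ => norm_nonneg _, fun Λ φ hφ => ?_⟩
  · have : w ∉ Function.support η := by
      rw [hη, b.support_normed_eq]
      simpa using hw
    simpa using this
  have hloc : LocallyIntegrable φ (volume : Measure (Em m)) := hφ.continuous.locallyIntegrable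
  let ℓ := ContinuousLinearMap.mul ℝ ℝ
  have hD : ∀ x, HasFDerivAt (fun x => ∫ w, η w * φ (x - w))
      (convolution (fderiv ℝ η) φ (ℓ.precompL (Em m)) volume x) x := fun x =>
    hηc.hasFDerivAt_convolution_left ℓ hηd hloc x
  have hLip : ∀ x y, ‖convolution (fderiv ℝ η) φ (ℓ.precompL (Em m)) volume x -
      convolution (fderiv ℝ η) φ (ℓ.precompL (Em m)) volume y‖ ≤
        Λ * (∫ t, ‖fderiv ℝ η t‖) * ‖x - y‖ := by
    intro x y
    have hex := hds.convolutionExists_left (ℓ.precompL (Em m)) hdc hloc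
    rw [convolution_def, convolution_def, ← integral_sub (hex x) (hex y)]
    have : Λ * (∫ t, ‖fderiv ℝ η t‖) * ‖x - y‖ = ∫ t, ‖fderiv ℝ η t‖ * (Λ * ‖x - y‖) := by
      rw [integral_mul_const]; ring
    rw [this]
    refine norm_integral_le_of_norm_le (hdi.mul_const _) (Eventually.of_forall fun t => ?_)
    rw [← map_sub]
    refine ContinuousLinearMap.opNorm_le_bound _ (by positivity) fun v => ?_
    have h1 := hφ.dist_le_mul (x - t) (y - t)
    rw [dist_eq_norm, dist_eq_norm, sub_sub_sub_cancel_right] at h1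
    have h2 := (fderiv ℝ η t).le_opNorm v
    simp only [ContinuousLinearMap.precompL_apply, ℓ, ContinuousLinearMap.mul_apply', norm_mul]
    calc _ ≤ (‖fderiv ℝ η t‖ * ‖v‖) * (Λ * ‖x - y‖) := by gcongr
      _ = _ := by ring
  refine ⟨hηc.contDiff_convolution_left ℓ hηd hloc, fun x v => ?_⟩
  have key := Convex.norm_image_sub_le_of_norm_hasFDerivWithin_le'
    (f := fun x => ∫ w, η w * φ (x - w)) (s := closedBall x ‖v‖)
    (φ := convolution (fderiv ℝ η) φ (ℓ.precompL (Em m)) volume x)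
    (C := Λ * (∫ t, ‖fderiv ℝ η t‖) * ‖v‖)
    (fun z _ => (hD z).hasFDerivWithinAt) (fun z hz => ?_) (convex_closedBall _ _)
    (mem_closedBall_self (norm_nonneg v)) (by simp : x + v ∈ closedBall x ‖v‖)
  · rw [(hD x).fderiv]
    rw [Real.norm_eq_abs, add_sub_cancel_left] at key
    refine key.trans_eq (by ring)
  · refine (hLip z x).trans ?_
    rw [mem_closedBall, dist_eq_norm] at hz
    have : 0 ≤ ∫ t, ‖fderiv ℝ η t‖ := integral_nonneg fun _ => norm_nonneg _
    gcongr

/-- Regularization moves a Lipschitz function only a little. -/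
lemma abs_mollify_sub_le {η : Em m → ℝ} (hc : Continuous η) (hs : HasCompactSupport η)
    (h0 : ∀ w, 0 ≤ η w) (h1 : ∫ w, η w = 1) {s : ℝ} (hz : ∀ w, s ≤ ‖w‖ → η w = 0)
    {Λ : ℝ≥0} {φ : Em m → ℝ} (hφ : LipschitzWith Λ φ) (x : Em m) :
    |(∫ w, η w * φ (x - w)) - φ x| ≤ Λ * s := by
  have hi : Integrable η := hc.integrable_of_hasCompactSupport hs
  have hi' : Integrable fun w => η w * φ (x - w) :=
    (hc.mul (hφ.continuous.comp (continuous_const.sub continuous_id))).integrable_of_hasCompactSupport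
      hs.mul_right
  have e : (∫ w, η w * φ (x - w)) - φ x = ∫ w, (η w * φ (x - w) - η w * φ x) := by
    rw [integral_sub hi' (hi.mul_const _), integral_mul_const, h1, one_mul]
  have e2 : (Λ:ℝ) * s = ∫ w, η w * (Λ * s) := by rw [integral_mul_const, h1, one_mul]
  rw [e, e2, ← Real.norm_eq_abs]
  refine norm_integral_le_of_norm_le (hi.mul_const _) (Eventually.of_forall fun w => ?_)
  rcases le_or_gt s ‖w‖ with h | h
  · simp [hz w h]
  rw [← mul_sub, norm_mul, Real.norm_of_nonneg (h0 w)]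
  have h2 := hφ.dist_le_mul (x - w) x
  rw [dist_eq_norm, dist_eq_norm, sub_sub_cancel_left, norm_neg] at h2
  have := h0 w
  have : (Λ:ℝ) * ‖w‖ ≤ Λ * s := by gcongr
  gcongr
  exact h2.trans this

section
variable {U : Set (Dd d)} {f : Dd d → Em m → Em m} {q : Dd d × Em m → ℝ} {V0 : Em m → ℝ}
  {B T : ℝ} {L Lq M : ℝ≥0} {K : Set (Em m)} {μ : Measure (Dd d × Em m)}

lemma ae_mem_of_measure_prod_eq_one [IsProbabilityMeasure μ] (hU : IsCompact U)
    (hK : IsCompact K) (hμ : μ (U ×ˢ K) = 1) : ∀ᵐ p ∂μ, p ∈ U ×ˢ K :=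
  (prob_compl_eq_zero_iff (hU.prod hK).measurableSet).2 hμ

lemma integrable_of_measure_prod_eq_one [IsProbabilityMeasure μ] (hU : IsCompact U)
    (hK : IsCompact K) (hμ : μ (U ×ˢ K) = 1) {G : Dd d × Em m → ℝ}
    (hG : ContinuousOn G (U ×ˢ K)) : Integrable G μ := by
  have := hG.integrableOn_compact (μ := μ) (hU.prod hK)
  rwa [IntegrableOn,
    Measure.restrict_eq_self_of_ae_mem (ae_mem_of_measure_prod_eq_one hU hK hμ)] at this

/-- One step of the dynamic programming inequality for the regularized value function,
averaged against a measure that annihilates the generator. -/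
lemma integral_mollify_val_add_le [IsProbabilityMeasure μ] (hU : IsCompact U)
    (hne : U.Nonempty)
    (hf : Continuous fun p : Dd d × Em m => f p.1 p.2) (hL : ∀ v ∈ U, LipschitzWith L (f v))
    (hq : Continuous q) (hB : ∀ p, |q p| ≤ B) (hqL : ∀ v ∈ U, LipschitzWith Lq fun y => q (v, y))
    (h0 : ∀ y, 0 ≤ V0 y) (hK : IsCompact K) (hμ : μ (U ×ˢ K) = 1)
    (hgen : ∀ φ : Em m → ℝ, ContDiff ℝ 1 φ → ∫ p, fderiv ℝ φ p.2 (f p.1 p.2) ∂μ = 0)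
    {Λ : ℝ≥0} (hT : 0 ≤ T) (hΛ : LipschitzWith Λ (val U f q V0 T)) {h : ℝ} (hh : 0 ≤ h)
    (hh1 : h ≤ 1) {Λ' : ℝ≥0} (hΛ' : LipschitzWith Λ' (val U f q V0 (h + T)))
    {s Bf A : ℝ} (hBf : ∀ v ∈ U, ∀ x, infDist x K < s → ‖f v x‖ ≤ Bf)
    (hBf' : ∀ v ∈ U, ∀ x ∈ K, ‖f v x‖ ≤ Bf) {η : Em m → ℝ}
    (hc : Continuous η) (hcs : HasCompactSupport η) (hη0 : ∀ w, 0 ≤ η w) (hη1 : ∫ w, η w = 1)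
    (hz : ∀ w, s ≤ ‖w‖ → η w = 0) (hA0 : 0 ≤ A)
    (hA : ∀ (Λ : ℝ≥0) (φ : Em m → ℝ), LipschitzWith Λ φ →
        ContDiff ℝ 1 (fun x => ∫ w, η w * φ (x - w)) ∧
        ∀ x v, |(∫ w, η w * φ (x + v - w)) - (∫ w, η w * φ (x - w)) -
          fderiv ℝ (fun x => ∫ w, η w * φ (x - w)) x v| ≤ Λ * A * ‖v‖ ^ 2) :
    ∫ p, (∫ w, η w * val U f q V0 (h + T) (p.2 - w)) ∂μ ≤
      h * (∫ p, q p ∂μ) + (∫ p, (∫ w, η w * val U f q V0 T (p.2 - w)) ∂μ) +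
        (h * (s * (Lq + Λ * L)) +
          ((Lq + Λ * L) * (Bf * Real.exp L) + Λ * A * Bf ^ 2) * h ^ 2) := by
  obtain ⟨hC, hTay⟩ := hA Λ _ hΛ
  obtain ⟨hC', -⟩ := hA Λ' _ hΛ'
  have hi : Integrable η := hc.integrable_of_hasCompactSupport hcs
  have hmi : ∀ {Λ : ℝ≥0} {φ : Em m → ℝ}, LipschitzWith Λ φ → ∀ x,
      Integrable fun w => η w * φ (x - w) := fun hφ x =>
    (hc.mul (hφ.continuous.comp (continuous_const.sub continuous_id))).integrable_of_hasCompactSupport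
      hcs.mul_right
  set φs : Em m → ℝ := fun x => ∫ w, η w * val U f q V0 T (x - w) with hφs
  set c : ℝ := h * (s * (Lq + Λ * L)) + (Lq + Λ * L) * (Bf * Real.exp L) * h ^ 2 with hcdef
  have hpt : ∀ p ∈ U ×ˢ K, ∫ w, η w * val U f q V0 (h + T) (p.2 - w) ≤
      h * q p + φs p.2 + h * fderiv ℝ φs p.2 (f p.1 p.2) + (c + Λ * A * Bf ^ 2 * h ^ 2) := by
    rintro ⟨v, y⟩ ⟨hv, hy⟩
    simp only at hv hy ⊢
    have hBy := hBf' v hv y hy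
    have h1 : ∫ w, η w * val U f q V0 (h + T) (y - w) ≤
        ∫ w, (η w * (h * q (v, y) + c) + η w * val U f q V0 T (y + h • f v y - w)) := by
      refine integral_mono (hmi hΛ' _) ((hi.mul_const _).add (hmi hΛ _)) fun w => ?_
      simp only
      rw [← mul_add]
      rcases le_or_gt s ‖w‖ with hw | hw
      · simp [hz w hw]
      refine mul_le_mul_of_nonneg_left ?_ (hη0 w)
      have hBw : ∀ v ∈ U, ‖f v (y - w)‖ ≤ Bf := fun v hv => by
        refine hBf v hv _ ((infDist_le_dist_of_mem hy).trans_lt ?_)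
        rwa [dist_eq_norm, sub_sub_cancel_left, norm_neg]
      have k1 := val_add_le hU hne hf hL hq hB hqL h0 hT hΛ hh hh1 hBw hv
      have k2 := (le_abs_self _).trans ((hqL v hv).dist_le_mul (y - w) y)
      have k3 := (le_abs_self _).trans
        (hΛ.dist_le_mul (y - w + h • f v (y - w)) (y + h • f v y - w))
      have k4 := (hL v hv).dist_le_mul (y - w) y
      simp only [dist_eq_norm, sub_sub_cancel_left, norm_neg] at k2 k3 k4
      have e : y - w + h • f v (y - w) - (y + h • f v y - w) = h • (f v (y - w) - f v y) := by
        rw [smul_sub]; abel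
      rw [e, norm_smul, Real.norm_of_nonneg hh] at k3
      have k5 : ‖f v (y - w) - f v y‖ ≤ L * s := k4.trans (by gcongr)
      have k6 : (Lq : ℝ) * ‖w‖ ≤ Lq * s := by gcongr
      have k7 : (Λ : ℝ) * (h * ‖f v (y - w) - f v y‖) ≤ Λ * (h * (L * s)) := by gcongr
      have k8 : h * (q (v, y - w) - q (v, y)) ≤ h * (Lq * s) :=
        mul_le_mul_of_nonneg_left (k2.trans k6) hh
      rw [hcdef]
      linarith
    rw [integral_add (hi.mul_const _) (hmi hΛ _), integral_mul_const, hη1, one_mul] at h1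
    have h2 := (le_abs_self _).trans (hTay y (h • f v y))
    rw [norm_smul, Real.norm_of_nonneg hh, map_smul, smul_eq_mul] at h2
    have h3 : (Λ : ℝ) * A * (h * ‖f v y‖) ^ 2 ≤ Λ * A * (h * Bf) ^ 2 := by gcongr
    simp only [hφs] at h2 ⊢
    linarith
  have hcf := hC.continuous_fderiv one_ne_zero
  have iq : Integrable q μ := integrable_of_measure_prod_eq_one hU hK hμ hq.continuousOn
  have iφ : Integrable (fun p : Dd d × Em m => φs p.2) μ :=
    integrable_of_measure_prod_eq_one hU hK hμ (hC.continuous.comp continuous_snd).continuousOn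
  have iφ' : Integrable (fun p : Dd d × Em m =>
      ∫ w, η w * val U f q V0 (h + T) (p.2 - w)) μ :=
    integrable_of_measure_prod_eq_one hU hK hμ (hC'.continuous.comp continuous_snd).continuousOn
  have idf : Integrable (fun p : Dd d × Em m => fderiv ℝ φs p.2 (f p.1 p.2)) μ :=
    integrable_of_measure_prod_eq_one hU hK hμ
      ((hcf.comp continuous_snd).clm_apply hf).continuousOn
  have i1 : Integrable (fun p => h * q p + φs p.2) μ := (iq.const_mul h).add iφ
  have i2 : Integrable (fun p => h * q p + φs p.2 + h * fderiv ℝ φs p.2 (f p.1 p.2)) μ :=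
    i1.add (idf.const_mul h)
  have := integral_mono_ae iφ' (i2.add (integrable_const (c + Λ * A * Bf ^ 2 * h ^ 2)))
    ((ae_mem_of_measure_prod_eq_one hU hK hμ).mono fun p hp => hpt p hp)
  refine this.trans ?_
  simp only [Pi.add_apply]
  rw [integral_add i2 (integrable_const _), integral_add i1 (idf.const_mul h),
    integral_add (iq.const_mul h) iφ, integral_const_mul, integral_const_mul, hgen _ hC]
  simp only [integral_const, probReal_univ, smul_eq_mul, one_mul, hcdef]
  linarith

/-- The averaged value function is bounded by the averaged running cost. -/
lemma integral_val_le [IsProbabilityMeasure μ] (hU : IsCompact U)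
    (hne : U.Nonempty)
    (hf : Continuous fun p : Dd d × Em m => f p.1 p.2) (hL : ∀ v ∈ U, LipschitzWith L (f v))
    (hq : Continuous q) (hB : ∀ p, |q p| ≤ B) (hqL : ∀ v ∈ U, LipschitzWith Lq fun y => q (v, y))
    (h0 : ∀ y, 0 ≤ V0 y) (hM : LipschitzWith M V0) (hK : IsCompact K) (hVK : ∀ y ∈ K, V0 y = 0)
    (hμ : μ (U ×ˢ K) = 1)
    (hgen : ∀ φ : Em m → ℝ, ContDiff ℝ 1 φ → ∫ p, fderiv ℝ φ p.2 (f p.1 p.2) ∂μ = 0)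
    (N : ℝ≥0) {ε : ℝ} (hε : 0 < ε) :
    ∫ p, val U f q V0 N p.2 ∂μ ≤ N * (∫ p, q p ∂μ) + ε := by
  set Λ : ℝ≥0 := (Lq * N + M) * (Real.exp (L * N)).toNNReal with hΛdef
  have hΛ : ∀ T : ℝ, 0 ≤ T → T ≤ N → LipschitzWith Λ (val U f q V0 T) := fun T hT hTN =>
    lipschitzWith_val hU hne hf hL hq hB hqL h0 hM hT hTN
  obtain ⟨Bf, hBf⟩ := (hU.prod (hK.cthickening (r := 1))).exists_bound_of_continuousOn
    (f := fun p : Dd d × Em m => f p.1 p.2) hf.continuousOn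
  obtain ⟨s, hs0, hs1, hsε⟩ : ∃ s : ℝ, 0 < s ∧ s ≤ 1 ∧
      s * (2 * Λ + N * (Lq + Λ * L)) ≤ ε / 2 := by
    have hP : (0:ℝ) < 2 * Λ + N * (Lq + Λ * L) + 1 := by positivity
    refine ⟨min 1 (ε / 2 / (2 * Λ + N * (Lq + Λ * L) + 1)), by positivity, min_le_left _ _, ?_⟩
    calc _ ≤ (ε / 2 / (2 * Λ + N * (Lq + Λ * L) + 1)) * (2 * Λ + N * (Lq + Λ * L) + 1) := by
          exact mul_le_mul (min_le_right _ _) (by linarith) (by positivity) (by positivity)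
      _ = ε / 2 := by field_simp
  obtain ⟨η, hc, hcs, hη0, hη1, hz, A, hA0, hA⟩ := exists_mollifier m hs0
  set D : ℝ := (Lq + Λ * L) * (Bf * Real.exp L) + Λ * A * Bf ^ 2 with hD
  obtain ⟨n, hn⟩ := exists_nat_gt (max N (max 0 (2 * |D| * N ^ 2 / ε)) : ℝ)
  have hnN : (N : ℝ) < n := (le_max_left _ _).trans_lt hn
  have hn0 : (0:ℝ) < n := ((le_max_left _ _).trans (le_max_right _ _)).trans_lt hn
  have hnD : 2 * |D| * N ^ 2 / ε < n := ((le_max_right _ _).trans (le_max_right _ _)).trans_lt hn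
  set h : ℝ := N / n with hhdef
  have hh : 0 ≤ h := by positivity
  have hh1 : h ≤ 1 := by rw [hhdef, div_le_one hn0]; exact hnN.le
  have hnh : n * h = N := by rw [hhdef]; field_simp
  set a : ℝ → ℝ := fun T => ∫ p, (∫ w, η w * val U f q V0 T (p.2 - w)) ∂μ with ha
  have hKs : ∀ T : ℝ, 0 ≤ T → T ≤ N →
      Integrable (fun p : Dd d × Em m => ∫ w, η w * val U f q V0 T (p.2 - w)) μ :=
    fun T h1 h2 => integrable_of_measure_prod_eq_one hU hK hμ
      ((hA Λ _ (hΛ T h1 h2)).1.continuous.comp continuous_snd).continuousOn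
  have hstep : ∀ i : ℕ, i ≤ n → a (i * h) ≤ i * h * (∫ p, q p ∂μ) + Λ * s +
      i * (h * (s * (Lq + Λ * L)) + D * h ^ 2) := by
    intro i
    induction i with
    | zero =>
      intro _
      have : a 0 ≤ ∫ p, (Λ * s : ℝ) ∂μ := by
        refine integral_mono_ae (hKs 0 le_rfl N.2) (integrable_const _)
          ((ae_mem_of_measure_prod_eq_one hU hK hμ).mono fun p hp => ?_)
        have := (le_abs_self _).trans
          (abs_mollify_sub_le hc hcs hη0 hη1 hz (hΛ 0 le_rfl N.2) p.2)
        rw [val_zero hU hne hf hL, hVK _ hp.2] at this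
        simpa using this
      simpa using this
    | succ i ih =>
      intro hi
      have hi' : (i : ℝ) + 1 ≤ n := by exact_mod_cast hi
      have hiN : (i : ℝ) * h ≤ N := by rw [← hnh]; gcongr; linarith
      have hiN' : h + (i : ℝ) * h ≤ N := by
        rw [← hnh]; nlinarith
      have h1 := integral_mollify_val_add_le hU hne hf hL hq hB hqL h0 hK hμ hgen
        (T := i * h) (by positivity) (hΛ _ (by positivity) hiN) hh hh1
        (hΛ (h + i * h) (by positivity) hiN') (Bf := Bf)
        (fun v hv x hx => hBf (v, x) ⟨hv, ?_⟩)
        (fun v hv x hx => hBf (v, x) ⟨hv, self_subset_cthickening _ hx⟩) hc hcs hη0 hη1 hz hA0 hA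
      · have e : ((i + 1 : ℕ) : ℝ) * h = h + i * h := by push_cast; ring
        have h2 := ih (by omega)
        rw [e]
        push_cast
        simp only [ha, ← hD] at h1 h2 ⊢
        linarith
      · have hKne : K.Nonempty := by
          obtain ⟨p, hp⟩ := (ae_mem_of_measure_prod_eq_one hU hK hμ).exists
          exact ⟨p.2, hp.2⟩
        obtain ⟨y, hy, hxy⟩ := (infDist_lt_iff hKne).1 hx
        exact mem_cthickening_of_dist_le x y 1 K hy (hxy.le.trans hs1)
  have hlast := hstep n le_rfl
  rw [hnh] at hlast
  have hfin : ∫ p, val U f q V0 N p.2 ∂μ ≤ a N + Λ * s := by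
    have iv : Integrable (fun p : Dd d × Em m => val U f q V0 N p.2) μ :=
      integrable_of_measure_prod_eq_one hU hK hμ
        ((hΛ N N.2 le_rfl).continuous.comp continuous_snd).continuousOn
    have := integral_mono iv ((hKs N N.2 le_rfl).add (integrable_const (Λ * s : ℝ))) fun p => ?_
    · simp only [Pi.add_apply] at this
      rw [integral_add (hKs N N.2 le_rfl) (integrable_const _)] at this
      simpa using this
    · have := (neg_abs_le _).trans' (neg_le_neg
          (abs_mollify_sub_le hc hcs hη0 hη1 hz (hΛ N N.2 le_rfl) p.2))
      simp only [Pi.add_apply]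
      linarith
  have hDh : n * (D * h ^ 2) ≤ ε / 2 := by
    have e : n * (D * h ^ 2) = D * N ^ 2 / n := by rw [hhdef]; field_simp
    rw [e, div_le_iff₀ hn0]
    rw [div_lt_iff₀ hε] at hnD
    have : D * (N : ℝ) ^ 2 ≤ |D| * N ^ 2 := by gcongr; exact le_abs_self D
    linarith
  have e2 : (n : ℝ) * (h * (s * (Lq + Λ * L))) = N * (s * (Lq + Λ * L)) := by rw [← hnh]; ring
  linarith

end

section
variable {U : Set (Dd d)} {f : Dd d → Em m → Em m} {q : Dd d × Em m → ℝ}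
  {B T₀ : ℝ} {L Lq : ℝ≥0} {K : Set (Em m)} {μ : Measure (Dd d × Em m)}

/-- A measure annihilating the generator is dominated, for a given running cost, by a
trajectory that starts in `K` and ends close to `K`. -/
lemma exists_traj_integral_le [IsProbabilityMeasure μ] (hU : IsCompact U)
    (hf : Continuous fun p : Dd d × Em m => f p.1 p.2) (hL : ∀ v ∈ U, LipschitzWith L (f v))
    (hq : Continuous q) (hB : ∀ p, |q p| ≤ B) (hqL : ∀ v ∈ U, LipschitzWith Lq fun y => q (v, y))
    (hK : IsCompact K) (hμ : μ (U ×ˢ K) = 1)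
    (hgen : ∀ φ : Em m → ℝ, ContDiff ℝ 1 φ → ∫ p, fderiv ℝ φ p.2 (f p.1 p.2) ∂μ = 0)
    (N : ℝ≥0) {ε : ℝ} (hε : 0 < ε) :
    ∃ v w, Traj U f v w ∧ w 0 ∈ K ∧
      ∫ s in (0:ℝ)..N, q (v s, w s) ≤ N * (∫ p, q p ∂μ) + ε ∧ infDist (w N) K ≤ ε := by
  obtain ⟨⟨u0, y0⟩, hu0, hy0⟩ := (ae_mem_of_measure_prod_eq_one hU hK hμ).exists
  have hne : U.Nonempty := ⟨u0, hu0⟩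
  have hB0 : 0 ≤ B := (abs_nonneg _).trans (hB (u0, y0))
  set M : ℝ≥0 := ((2 * B * N + ε) / ε).toNNReal with hMdef
  have hM : (M : ℝ) = (2 * B * N + ε) / ε := Real.coe_toNNReal _ (by positivity)
  have h0 : ∀ y : Em m, 0 ≤ (M : ℝ) * infDist y K := fun y => mul_nonneg M.coe_nonneg infDist_nonneg
  have hV : LipschitzWith M fun y : Em m => (M : ℝ) * infDist y K := by
    refine LipschitzWith.of_dist_le_mul fun x y => ?_
    have := (lipschitz_infDist_pt K).dist_le_mul x y
    rw [NNReal.coe_one, one_mul] at this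
    rw [Real.dist_eq, ← mul_sub, abs_mul, abs_of_nonneg M.coe_nonneg]
    exact mul_le_mul_of_nonneg_left this M.coe_nonneg
  have hVK : ∀ y ∈ K, (M : ℝ) * infDist y K = 0 := fun y hy => by
    rw [infDist_zero_of_mem hy, mul_zero]
  have h1 := integral_val_le hU hne hf hL hq hB hqL h0 hV hK hVK hμ hgen N (half_pos hε)
  have hi : Integrable (fun p : Dd d × Em m =>
      val U f q (fun y => (M : ℝ) * infDist y K) N p.2) μ :=
    integrable_of_measure_prod_eq_one hU hK hμ
      ((lipschitzWith_val hU hne hf hL hq hB hqL h0 hV N.coe_nonneg le_rfl).continuous.comp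
        continuous_snd).continuousOn
  obtain ⟨p, hp, hle⟩ := exists_notMem_null_le_integral hi
    (ae_mem_of_measure_prod_eq_one hU hK hμ)
  replace hp : p ∈ U ×ˢ K := by simpa using hp
  obtain ⟨v, w, hw, hw0, hlt⟩ := exists_cost_lt hU hne hf hL q
    (fun y => (M : ℝ) * infDist y K) N p.2 (half_pos hε)
  rw [cost] at hlt
  refine ⟨v, w, hw, hw0 ▸ hp.2, ?_, ?_⟩
  · have := h0 (w N)
    linarith
  · have h2 : ‖∫ s in (0:ℝ)..N, q (v s, w s)‖ ≤ B * |(N : ℝ) - 0| :=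
      intervalIntegral.norm_integral_le_of_norm_le_const fun s _ => hB _
    rw [sub_zero, abs_of_nonneg N.coe_nonneg, Real.norm_eq_abs] at h2
    have h3 := neg_le_of_abs_le h2
    have h4 : ‖∫ p, q p ∂μ‖ ≤ B * μ.real univ :=
      norm_integral_le_of_norm_le_const (Eventually.of_forall hB)
    rw [probReal_univ, mul_one, Real.norm_eq_abs] at h4
    have h5 : (N : ℝ) * (∫ p, q p ∂μ) ≤ N * B :=
      mul_le_mul_of_nonneg_left (le_of_abs_le h4) N.coe_nonneg
    have h6 : (M : ℝ) * infDist (w N) K ≤ M * ε := by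
      rw [hM, div_mul_cancel₀ _ hε.ne', ← hM]
      linarith
    have h7 : (0 : ℝ) < M := by rw [hM]; positivity
    exact le_of_mul_le_mul_left h6 h7

/-- Any two points of `K` can be joined within time `T₀` (the transit may leave `K`). -/
def Joinable (U : Set (Dd d)) (f : Dd d → Em m → Em m) (K : Set (Em m)) (T₀ : ℝ) : Prop :=
  ∀ p ∈ K, ∀ x ∈ K, ∃ u w, Traj U f u w ∧ w 0 = p ∧ ∃ T ∈ Icc 0 T₀, w T = x

variable {ι : Type*} [Fintype ι] {g : ι → Dd d × Em m → ℝ} {Lg : ℝ≥0}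

/-- One stage of the greedy construction: the new occupation times `X` correct the current
defect `D` in the mean. -/
lemma exists_stage [IsProbabilityMeasure μ] (hU : IsCompact U)
    (hf : Continuous fun p : Dd d × Em m => f p.1 p.2) (hL : ∀ v ∈ U, LipschitzWith L (f v))
    (hg0 : ∀ j p, 0 ≤ g j p) (hg1 : ∀ j p, g j p ≤ 1) (hgL : ∀ j, LipschitzWith Lg (g j))
    (hK : IsCompact K) (hμ : μ (U ×ˢ K) = 1)
    (hgen : ∀ φ : Em m → ℝ, ContDiff ℝ 1 φ → ∫ p, fderiv ℝ φ p.2 (f p.1 p.2) ∂μ = 0)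
    (hJ : Joinable U f K T₀) (N : ℝ≥0) {ε : ℝ} (hε : 0 < ε) {p : Em m} (hp : p ∈ K)
    (D : ι → ℝ) :
    ∃ v w, Traj U f v w ∧ w 0 = p ∧ ∃ r ∈ Icc 0 (T₀ + N), ∃ p' ∈ K, ‖w r - p'‖ ≤ ε ∧
      ∃ X : ι → ℝ, (∀ j, 0 ≤ X j ∧ X j ≤ N) ∧ ∑ j, D j * (N * (∫ p, g j p ∂μ) - X j) ≤ ε ∧
        ∀ j, X j ≤ ∫ s in (0:ℝ)..r, g j (v s, w s) := by
  have hgc : ∀ j, Continuous (g j) := fun j => (hgL j).continuous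
  have hgi : ∀ j, Integrable (g j) μ := fun j =>
    integrable_of_measure_prod_eq_one hU hK hμ (hgc j).continuousOn
  set q : Dd d × Em m → ℝ := fun p => ∑ j, -(D j * g j p) with hqdef
  have hqc : Continuous q := by fun_prop
  have hqB : ∀ p, |q p| ≤ ∑ j, |D j| := fun p => by
    refine (Finset.abs_sum_le_sum_abs _ _).trans (Finset.sum_le_sum fun j _ => ?_)
    rw [abs_neg, abs_mul, abs_of_nonneg (hg0 j p)]
    exact mul_le_of_le_one_right (abs_nonneg _) (hg1 j p)
  have hqL : ∀ v ∈ U, LipschitzWith (∑ j, ‖D j‖₊ * Lg) fun y => q (v, y) := fun v _ => by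
    refine LipschitzWith.of_dist_le_mul fun x y => ?_
    rw [Real.dist_eq, hqdef, ← Finset.sum_sub_distrib]
    push_cast
    rw [Finset.sum_mul]
    refine (Finset.abs_sum_le_sum_abs _ _).trans (Finset.sum_le_sum fun j _ => ?_)
    have h1 := (hgL j).dist_le_mul (v, x) (v, y)
    rw [Real.dist_eq, Prod.dist_eq, dist_self, max_eq_right dist_nonneg] at h1
    rw [neg_sub_neg, ← mul_sub, abs_mul, abs_sub_comm, mul_assoc, Real.norm_eq_abs]
    exact mul_le_mul_of_nonneg_left h1 (abs_nonneg _)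
  obtain ⟨v, w, hw, hw0, hle, hd⟩ := exists_traj_integral_le hU hf hL hqc hqB hqL hK hμ hgen N hε
  obtain ⟨v₁, w₁, hw₁, hw₁0, T, hT, hTx⟩ := hJ p hp (w 0) hw0
  obtain ⟨vc, wc, hc, hcA, hcB, hcC⟩ := hw₁.concat hw hU hf hT.1 hTx.symm
  obtain ⟨p', hp', hpd⟩ := hK.exists_infDist_eq_dist ⟨p, hp⟩ (w N)
  refine ⟨vc, wc, hc, (hcA 0 hT.1).2.trans hw₁0, T + N, ⟨add_nonneg hT.1 N.coe_nonneg, by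
    linarith [hT.2]⟩, p', hp', ?_, fun j => ∫ s in (0:ℝ)..N, g j (v s, w s), fun j => ⟨?_, ?_⟩,
    ?_, fun j => ?_⟩
  · rw [hcC N N.coe_nonneg, ← dist_eq_norm, ← hpd]
    exact hd
  · exact intervalIntegral.integral_nonneg N.coe_nonneg fun s _ => hg0 j _
  · have := intervalIntegral.integral_mono_on N.coe_nonneg (hw.intervalIntegrable hU (hgc j) 0 N)
      (intervalIntegrable_const (c := (1:ℝ))) fun s _ => hg1 j _
    simpa using this
  · have e1 : ∫ p, q p ∂μ = ∑ j, -(D j * ∫ p, g j p ∂μ) := by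
      simp only [hqdef, Finset.sum_neg_distrib, integral_neg]
      rw [integral_finsetSum _ fun j _ => (hgi j).const_mul _]
      simp only [integral_const_mul]
    have e2 : ∫ s in (0:ℝ)..N, q (v s, w s) =
        ∑ j, -(D j * ∫ s in (0:ℝ)..N, g j (v s, w s)) := by
      simp only [hqdef, Finset.sum_neg_distrib, intervalIntegral.integral_neg]
      rw [intervalIntegral.integral_finsetSum fun j _ =>
        (hw.intervalIntegrable hU (hgc j) 0 N).const_mul _]
      simp only [intervalIntegral.integral_const_mul]
    rw [e1, e2, Finset.mul_sum] at hle
    have : ∑ j, D j * (N * (∫ p, g j p ∂μ) - ∫ s in (0:ℝ)..N, g j (v s, w s)) =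
        ∑ j, -(D j * ∫ s in (0:ℝ)..N, g j (v s, w s)) -
          ∑ j, (N:ℝ) * -(D j * ∫ p, g j p ∂μ) := by
      rw [← Finset.sum_sub_distrib]
      exact Finset.sum_congr rfl fun j _ => by ring
    rw [this]
    linarith
  · rw [integral_eq_add_of_concat (hgc j) hU hT.1 N.coe_nonneg hc hcA hcB hcC]
    have := intervalIntegral.integral_nonneg (μ := volume) hT.1
      fun s _ => hg0 j (v₁ s, w₁ s)
    linarith

/-- Greedy concatenation of stages (a Blackwell-type argument): the accumulated defect has
squared norm growing only linearly in the number of stages. -/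
lemma exists_traj_of_stages [IsProbabilityMeasure μ] (hU : IsCompact U)
    (hf : Continuous fun p : Dd d × Em m => f p.1 p.2) (hL : ∀ v ∈ U, LipschitzWith L (f v))
    (hg0 : ∀ j p, 0 ≤ g j p) (hg1 : ∀ j p, g j p ≤ 1) (hgL : ∀ j, LipschitzWith Lg (g j))
    (hK : IsCompact K) (hμ : μ (U ×ˢ K) = 1)
    (hgen : ∀ φ : Em m → ℝ, ContDiff ℝ 1 φ → ∫ p, fderiv ℝ φ p.2 (f p.1 p.2) ∂μ = 0)
    (hT₀ : 0 ≤ T₀) (hJ : Joinable U f K T₀) (N : ℝ≥0) {y₀ : Em m} (hy₀ : y₀ ∈ K) (i : ℕ) :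
    ∀ ε > (0:ℝ), ∃ u w, Traj U f u w ∧ w 0 = y₀ ∧ ∃ t ∈ Icc 0 (i * (T₀ + N)),
      (∃ p ∈ K, ‖w t - p‖ ≤ ε) ∧ ∃ D : ι → ℝ,
        ∑ j, D j ^ 2 ≤ i * (Fintype.card ι * N ^ 2 + 1) ∧
        ∀ j, i * N * (∫ p, g j p ∂μ) - D j - ε ≤ ∫ s in (0:ℝ)..t, g j (u s, w s) := by
  have hgc : ∀ j, Continuous (g j) := fun j => (hgL j).continuous
  induction i with
  | zero =>
    intro ε hε
    obtain ⟨⟨u0, _⟩, hu0, -⟩ := (ae_mem_of_measure_prod_eq_one hU hK hμ).exists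
    obtain ⟨w, hw, hw0⟩ := exists_traj hU hf hL (u := fun _ => u0) measurable_const
      (fun _ => hu0) y₀
    exact ⟨_, w, hw, hw0, 0, by simp, ⟨y₀, hy₀, by simp [hw0, hε.le]⟩, fun _ => 0, by simp,
      fun j => by simp [hε.le]⟩
  | succ i ih =>
    intro ε hε
    set R : ℝ := T₀ + N with hR
    have hR0 : 0 ≤ R := add_nonneg hT₀ N.coe_nonneg
    set A : ℝ := Real.exp (L * R) with hA
    have hA0 : 0 < A := Real.exp_pos _
    obtain ⟨ε₁, hε₁, hle₁⟩ : ∃ ε₁ > 0, ε₁ * (1 + A + Lg * A * R) = ε / 2 :=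
      ⟨ε / 2 / (1 + A + Lg * A * R), by positivity, by field_simp⟩
    obtain ⟨u, w, hw, hw0, t, ht, ⟨p, hp, hpt⟩, D, hD, hgD⟩ := ih ε₁ hε₁
    obtain ⟨v, w', hw', hw'0, r, hr, p', hp', hpr, X, hX, hDX, hXg⟩ :=
      exists_stage hU hf hL hg0 hg1 hgL hK hμ hgen hJ N
        (lt_min (half_pos hε) (half_pos one_pos)) hp D
    obtain ⟨w'', hw'', hw''0⟩ := exists_traj hU hf hL hw'.meas hw'.mem (w t)
    obtain ⟨uc, wc, hc, hcA, hcB, hcC⟩ := hw.concat hw'' hU hf ht.1 hw''0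
    have hLA : Real.exp (L * r) ≤ A := Real.exp_le_exp.2 (by gcongr; exact hr.2)
    have hstart : ‖w'' 0 - w' 0‖ ≤ ε₁ := by rw [hw''0, hw'0]; exact hpt
    have hAR : 0 ≤ Lg * A * R := by positivity
    refine ⟨uc, wc, hc, (hcA 0 ht.1).2.trans hw0, t + r, ⟨add_nonneg ht.1 hr.1, ?_⟩,
      ⟨p', hp', ?_⟩, fun j => D j + (N * (∫ p, g j p ∂μ) - X j), ?_, fun j => ?_⟩
    · have := ht.2
      have := hr.2
      push_cast
      linarith
    · rw [hcC r hr.1]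
      have h1 := hw''.norm_sub_le hw' hU hf hL hr.1
      have h2 : ‖w'' 0 - w' 0‖ * Real.exp (L * r) ≤ ε₁ * A := by gcongr
      have h3 := hpr.trans (min_le_left _ _)
      have h4 := norm_sub_le_norm_sub_add_norm_sub (w'' r) (w' r) p'
      nlinarith
    · have h1 : ∀ j, (N * (∫ p, g j p ∂μ) - X j) ^ 2 ≤ (N : ℝ) ^ 2 := fun j => by
        have m0 : 0 ≤ ∫ p, g j p ∂μ := integral_nonneg (hg0 j)
        have m1 : ∫ p, g j p ∂μ ≤ 1 := by
          have := integral_mono (integrable_of_measure_prod_eq_one hU hK hμ (hgc j).continuousOn)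
            (integrable_const (1:ℝ)) (hg1 j)
          simpa using this
        have := mul_nonneg N.coe_nonneg m0
        have := mul_le_mul_of_nonneg_left m1 N.coe_nonneg
        have := hX j
        exact sq_le_sq' (by linarith) (by linarith)
      have h2 : ∑ j, (N * (∫ p, g j p ∂μ) - X j) ^ 2 ≤ Fintype.card ι * (N : ℝ) ^ 2 := by
        simpa using Finset.sum_le_sum fun j (_ : j ∈ Finset.univ) => h1 j
      have h3 : ∑ j, (D j + (N * (∫ p, g j p ∂μ) - X j)) ^ 2 = ∑ j, D j ^ 2 +
          2 * ∑ j, D j * (N * (∫ p, g j p ∂μ) - X j) +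
          ∑ j, (N * (∫ p, g j p ∂μ) - X j) ^ 2 := by
        rw [Finset.mul_sum, ← Finset.sum_add_distrib, ← Finset.sum_add_distrib]
        exact Finset.sum_congr rfl fun j _ => by ring
      have h4 := hDX.trans (min_le_right _ _)
      push_cast
      linarith
    · rw [integral_eq_add_of_concat (hgc j) hU ht.1 hr.1 hc hcA hcB hcC]
      have h1 := integral_sub_le hU hf hL (hgc j)
        (fun v _ => (hgL j).comp (LipschitzWith.prodMk_left v)) hw'' hw' le_rfl hr.1
      have h2 := neg_le_of_abs_le h1
      have h3 : ((Lg * 1 : ℝ≥0) : ℝ) * (‖w'' 0 - w' 0‖ * Real.exp (L * r)) * (r - 0) ≤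
          Lg * (ε₁ * A) * R := by
        rw [mul_one, sub_zero]
        gcongr
        · exact hr.1
        · exact hr.2
      have h4 := hXg j
      have h5 := hgD j
      push_cast
      nlinarith

end

/-- Finitely many Lipschitz test functions control the Lévy–Prokhorov distance to measures
carried by a given compact set. -/
lemma exists_test_functions {X : Type} [MetricSpace X] [MeasurableSpace X] [BorelSpace X]
    {K : Set X} (hK : IsCompact K) {δ : ℝ} (hδ : 0 < δ) :
    ∃ (ι : Type) (_ : Fintype ι) (g : ι → X → ℝ) (Lg : ℝ≥0),
      (∀ j p, 0 ≤ g j p) ∧ (∀ j p, g j p ≤ 1) ∧ (∀ j, LipschitzWith Lg (g j)) ∧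
      ∀ (μ ν : Measure X) [IsProbabilityMeasure μ] [IsProbabilityMeasure ν], μ K = 1 →
        (∀ j, ∫ p, g j p ∂μ ≤ ∫ p, g j p ∂ν + δ) →
        levyProkhorovEDist μ ν ≤ ENNReal.ofReal δ := by
  have hη : 0 < δ / 4 := by positivity
  obtain ⟨t, -, ht, hKt⟩ := hK.finite_cover_balls hη
  have := ht.fintype
  refine ⟨Set t, inferInstance,
    fun I p => thickenedIndicator hη (⋃ c ∈ I, closedBall (c : X) (δ / 4)) p,
    (δ / 4).toNNReal⁻¹, fun j p => NNReal.coe_nonneg _, fun j p => ?_, fun j => ?_, ?_⟩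
  · exact_mod_cast thickenedIndicator_le_one hη _ p
  · exact LipschitzWith.of_dist_le_mul fun x y =>
      (lipschitzWith_thickenedIndicator hη _).dist_le_mul x y
  intro μ ν _ _ hμ hle
  refine levyProkhorovEDist_le_of_forall_le μ ν _ fun ε B hε hεt hB => ?_
  have hεr : δ < ε.toReal := (ENNReal.ofReal_lt_iff_lt_toReal hδ.le hεt.ne).1 hε
  set I : Set t := {c | (ball (c : X) (δ / 4) ∩ B).Nonempty} with hI
  set φ : X → ℝ := fun p => thickenedIndicator hη (⋃ c ∈ I, closedBall (c : X) (δ / 4)) p with hφ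
  have hφi : ∀ (ν : Measure X) [IsProbabilityMeasure ν], Integrable φ ν := fun ν _ => by
    refine Integrable.of_bound (C := 1) ?_ (Eventually.of_forall fun p => ?_)
    · exact (NNReal.continuous_coe.comp
        (thickenedIndicator hη _).continuous).measurable.aestronglyMeasurable
    · rw [Real.norm_of_nonneg (NNReal.coe_nonneg _)]
      exact_mod_cast thickenedIndicator_le_one hη _ p
  have hT : MeasurableSet (thickening ε.toReal B) := isOpen_thickening.measurableSet
  have h1 : μ.real B ≤ ∫ p, φ p ∂μ := by
    rw [← integral_indicator_one hB]
    refine integral_mono_ae ((integrable_const (1 : ℝ)).indicator hB) (hφi μ) ?_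
    have hKae : ∀ᵐ p ∂μ, p ∈ K := (prob_compl_eq_zero_iff hK.measurableSet).2 hμ
    filter_upwards [hKae] with p hp
    by_cases hpB : p ∈ B
    · obtain ⟨c, hc, hpc⟩ := mem_iUnion₂.1 (hKt hp)
      have hmem : p ∈ ⋃ c ∈ I, closedBall (c : X) (δ / 4) :=
        mem_iUnion₂.2 ⟨⟨c, hc⟩, ⟨p, hpc, hpB⟩, ball_subset_closedBall hpc⟩
      rw [indicator_of_mem hpB]
      simp only [hφ]
      rw [thickenedIndicator_one hη _ hmem]
      simp
    · rw [indicator_of_notMem hpB]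
      exact NNReal.coe_nonneg _
  have h2 : ∫ p, φ p ∂ν ≤ ν.real (thickening ε.toReal B) := by
    rw [← integral_indicator_one hT]
    refine integral_mono (hφi ν) ((integrable_const (1 : ℝ)).indicator hT) fun p => ?_
    by_cases hpT : p ∈ thickening ε.toReal B
    · rw [indicator_of_mem hpT]
      exact_mod_cast thickenedIndicator_le_one hη _ p
    · have hout : p ∉ thickening (δ / 4) (⋃ c ∈ I, closedBall (c : X) (δ / 4)) := by
        intro hp
        obtain ⟨x, hx, hpx⟩ := mem_thickening_iff.1 hp
        obtain ⟨c, ⟨b, hb, hbB⟩, hxc⟩ := mem_iUnion₂.1 hx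
        refine hpT (mem_thickening_iff.2 ⟨b, hbB, ?_⟩)
        have := dist_triangle4 p x c b
        rw [mem_closedBall] at hxc
        rw [mem_ball, dist_comm] at hb
        linarith
      rw [indicator_of_notMem hpT]
      simp only [hφ]
      rw [thickenedIndicator_zero hη _ hout]
      simp
  have h3 := hle I
  have h4 : μ.real B ≤ ν.real (thickening ε.toReal B) + ε.toReal := by
    simp only [hφ] at h1 h2
    linarith
  rw [← ENNReal.toReal_le_toReal (by finiteness) (by finiteness),
    ENNReal.toReal_add (by finiteness) hεt.ne]
  exact h4

section
variable {U : Set (Dd d)} {f : Dd d → Em m → Em m} {u : ℝ → Dd d} {w : ℝ → Em m} {S : ℝ}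

lemma isProbabilityMeasure_occ (hS : 0 < S) (hu : Measurable u) (hw : Measurable w) :
    IsProbabilityMeasure (occ u w S) := by
  constructor
  rw [occ, Measure.smul_apply, Measure.map_apply (hu.prodMk hw) MeasurableSet.univ]
  simp only [preimage_univ, Measure.restrict_apply_univ, Real.volume_Ioc, sub_zero, smul_eq_mul]
  exact ENNReal.inv_mul_cancel (by simpa using hS) ENNReal.ofReal_ne_top

lemma integral_occ (hS : 0 < S) (hu : Measurable u) (hw : Measurable w) {G : Dd d × Em m → ℝ}
    (hG : Continuous G) : ∫ p, G p ∂(occ u w S) = S⁻¹ * ∫ s in (0:ℝ)..S, G (u s, w s) := by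
  rw [occ, integral_smul_measure, integral_map (hu.prodMk hw).aemeasurable
    hG.aestronglyMeasurable, intervalIntegral.integral_of_le hS.le, ENNReal.toReal_inv,
    ENNReal.toReal_ofReal hS.le, smul_eq_mul]

lemma Traj.occ_mem_Mz (h : Traj U f u w) (hU : IsCompact U)
    (hf : Continuous fun p : Dd d × Em m => f p.1 p.2) (S : ℝ) :
    occ u w S ∈ Mz U f S (w 0) :=
  ⟨u, w, h.isControl, h.isSolOn hU hf, rfl, rfl⟩

/-- Uniform approximation of `W(z)` by occupational measures on long intervals. -/
lemma exists_forall_ρpt_le {F : Em m → Kk k} {Y : Set (Em m)} {Z : Set (Kk k)}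
    (hU : IsCompact U) (hY : IsCompact Y) (hf : Continuous fun p : Dd d × Em m => f p.1 p.2)
    {L : ℝ≥0} (hL : ∀ v ∈ U, LipschitzWith L (f v)) (hYz : ∀ z ∈ Z, lvl F z ⊆ Y)
    (hK : ∀ z ∈ Z, IsCompact (lvl F z)) {T₀ : ℝ} (hT₀ : 0 ≤ T₀)
    (hJ : ∀ z ∈ Z, Joinable U f (lvl F z) T₀) {δ : ℝ} (hδ : 0 < δ) :
    ∃ S₀ : ℝ, 0 < S₀ ∧ ∀ S ≥ S₀, ∀ z ∈ Z, ∀ y₀ ∈ lvl F z, ∀ μ ∈ W U f F z,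
      ρpt μ (Mz U f S y₀) ≤ ENNReal.ofReal δ := by
  obtain ⟨ι, _, g, Lg, hg0, hg1, hgL, htest⟩ := exists_test_functions (hU.prod hY) hδ
  obtain ⟨N, hN1, hNδ⟩ : ∃ N : ℝ≥0, (1:ℝ) ≤ N ∧ T₀ ≤ N * (δ / 4) := by
    refine ⟨⟨max 1 (T₀ / (δ / 4)), by positivity⟩, le_max_left _ _, ?_⟩
    have : T₀ = T₀ / (δ / 4) * (δ / 4) := by field_simp
    calc T₀ = T₀ / (δ / 4) * (δ / 4) := this
      _ ≤ _ := by gcongr; exact le_max_right _ _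
  have hN0 : (0:ℝ) < N := by linarith
  set R : ℝ := T₀ + N with hR
  have hR0 : 0 < R := by positivity
  set C : ℝ := Fintype.card ι * (N:ℝ) ^ 2 + 1 with hC
  have hC0 : 0 < C := by positivity
  obtain ⟨n₀, hn₀⟩ := exists_nat_gt (2 * (R + C / (δ * N) + 1) / (δ * N))
  have hn₀pos : (0:ℝ) < n₀ := lt_trans (by positivity) hn₀
  refine ⟨n₀ * R, by positivity, fun S hS z hz y₀ hy₀ μ hμ => ?_⟩
  have hS0 : 0 < S := lt_of_lt_of_le (by positivity) hS
  obtain ⟨hμP, hμ1, hgen⟩ := hμ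
  set n : ℕ := ⌊S / R⌋₊ with hn
  have hnS : n * R ≤ S := by
    rw [← le_div_iff₀ hR0]; exact Nat.floor_le (by positivity)
  have hSn : S < (n + 1) * R := by
    rw [← div_lt_iff₀ hR0]; exact Nat.lt_floor_add_one _
  have hn₀n : (n₀:ℝ) ≤ n := by
    exact_mod_cast Nat.le_floor ((le_div_iff₀ hR0).2 hS)
  obtain ⟨u, w, hw, hw0, t, ht, -, D, hD, hDg⟩ := exists_traj_of_stages hU hf hL hg0 hg1 hgL
    (hK z hz) hμ1 hgen hT₀ (hJ z hz) N hy₀ n 1 one_pos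
  have := isProbabilityMeasure_occ hS0 hw.meas hw.cont.measurable
  have hmem : occ u w S ∈ Mz U f S y₀ := hw0 ▸ hw.occ_mem_Mz hU hf S
  refine (iInf₂_le _ hmem).trans (htest μ _ ?_ fun j => ?_)
  · exact le_antisymm prob_le_one (hμ1 ▸ measure_mono (prod_mono le_rfl (hYz z hz)))
  have hgc : Continuous (g j) := (hgL j).continuous
  rw [integral_occ hS0 hw.meas hw.cont.measurable hgc]
  have htS : t ≤ S := ht.2.trans hnS
  have h1 : ∫ s in (0:ℝ)..t, g j (u s, w s) ≤ ∫ s in (0:ℝ)..S, g j (u s, w s) :=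
    intervalIntegral.integral_mono_interval le_rfl ht.1 htS
      (Eventually.of_forall fun s => hg0 j _) (hw.intervalIntegrable hU hgc 0 S)
  have h2 := hDg j
  have h3 : D j ^ 2 ≤ n * C :=
    (Finset.single_le_sum (fun i _ => sq_nonneg (D i)) (Finset.mem_univ j)).trans hD
  have m0 : 0 ≤ ∫ p, g j p ∂μ := integral_nonneg (hg0 j)
  have m1 : ∫ p, g j p ∂μ ≤ 1 := by
    have := integral_mono (integrable_of_measure_prod_eq_one hU (hK z hz) hμ1 hgc.continuousOn)
      (integrable_const (1:ℝ)) (hg1 j)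
    simpa using this
  have h4 : D j ≤ n * N * (δ / 4) + C / (δ * N) := by
    have ha : 0 < δ * N / (4 * C) := by positivity
    have e1 : δ * N / (4 * C) * (n * C) = n * N * (δ / 4) := by field_simp
    have e2 : D j ≤ δ * N / (4 * C) * D j ^ 2 + C / (δ * N) := by
      have : δ * N / (4 * C) * D j ^ 2 + C / (δ * N) - D j =
          δ * N / (4 * C) * (D j - 2 * C / (δ * N)) ^ 2 := by field_simp; ring
      have := mul_nonneg ha.le (sq_nonneg (D j - 2 * C / (δ * N)))
      linarith
    have := mul_le_mul_of_nonneg_left h3 ha.le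
    linarith
  have h5 : 2 * (R + C / (δ * N) + 1) ≤ n * (δ * N) := by
    have := (div_lt_iff₀ (by positivity)).1 hn₀
    have : (n₀ : ℝ) * (δ * N) ≤ n * (δ * N) := by gcongr
    linarith
  have h6 : (n : ℝ) * T₀ ≤ n * (N * (δ / 4)) := by gcongr
  have h7 : δ * (n * N) ≤ δ * S := by
    refine mul_le_mul_of_nonneg_left (le_trans ?_ hnS) hδ.le
    rw [hR]
    gcongr
    linarith
  have h8 : 0 ≤ S - n * N := by
    have : (n : ℝ) * N ≤ n * R := by
      rw [hR]
      gcongr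
      linarith
    linarith
  have h9 : (S - n * N) * (∫ p, g j p ∂μ) ≤ S - n * N := mul_le_of_le_one_right h8 m1
  have h10 : S * (∫ p, g j p ∂μ) ≤ (∫ s in (0:ℝ)..S, g j (u s, w s)) + δ * S := by
    have e : (n + 1) * R = n * T₀ + n * N + R := by rw [hR]; ring
    linarith
  have h11 : S * (∫ p, g j p ∂μ) ≤ S * (S⁻¹ * (∫ s in (0:ℝ)..S, g j (u s, w s)) + δ) := by
    rw [mul_add, mul_inv_cancel_left₀ hS0.ne']
    linarith
  exact le_of_mul_le_mul_left h11 hS0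

lemma ρpt_le_one {μ : Measure (Dd d × Em m)} [IsProbabilityMeasure μ] (hU : IsCompact U)
    (hne : U.Nonempty) (hf : Continuous fun p : Dd d × Em m => f p.1 p.2) {L : ℝ≥0}
    (hL : ∀ v ∈ U, LipschitzWith L (f v)) (hS : 0 < S) (y₀ : Em m) :
    ρpt μ (Mz U f S y₀) ≤ 1 := by
  obtain ⟨u0, hu0⟩ := hne
  obtain ⟨w, hw, rfl⟩ := exists_traj hU hf hL (u := fun _ => u0) measurable_const
    (fun _ => hu0) y₀
  have := isProbabilityMeasure_occ hS hw.meas hw.cont.measurable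
  exact (iInf₂_le _ (hw.occ_mem_Mz hU hf S)).trans
    ((levyProkhorovEDist_le_max_measure_univ _ _).trans (by simp))

end

/-- Proposition 3.3 of the paper: under the uniform controllability condition
on the invariant sets `Y_z`, Assumption 2 is satisfied. -/
theorem statement6
    {d m k : ℕ}
    (Uset : Set (Dd d)) (Yset : Set (Em m)) (Zset : Set (Kk k))
    (f g : Dd d → Em m → Em m) (F : Em m → Kk k) (r : Dd d → Em m → ℝ)
    (C : ℝ) (y₀ : Em m)
    (hU : IsCompact Uset) (hY : IsCompact Yset) (hZ : IsCompact Zset)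
    (hfC : Continuous fun p : Dd d × Em m => f p.1 p.2)
    (hgC : Continuous fun p : Dd d × Em m => g p.1 p.2)
    (hrC : Continuous fun p : Dd d × Em m => r p.1 p.2)
    (hfL : ∃ L : ℝ≥0, ∀ u ∈ Uset, LipschitzWith L (f u))
    (hgL : ∃ L : ℝ≥0, ∀ u ∈ Uset, LipschitzWith L (g u))
    (hrL : ∃ L : ℝ≥0, ∀ u ∈ Uset, LipschitzWith L (r u))
    (hF : ∃ V : Set (Em m), IsOpen V ∧ Yset ⊆ V ∧ ContDiffOn ℝ 1 F V ∧
      ∃ LF : ℝ≥0, LipschitzOnWith LF (fun y => fderiv ℝ F y) V)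
    (hInv : ∀ u ∈ Uset, ∀ y ∈ Yset, fderiv ℝ F y (f u y) = 0)
    (hYzY : ∀ z ∈ Zset, lvl F z ⊆ Yset)
    (hYzLip : ∃ L0 : ℝ, 0 ≤ L0 ∧ ∀ z' ∈ Zset, ∀ z'' ∈ Zset,
      hausdorffDist (lvl F z') (lvl F z'') ≤ L0 * ‖z' - z''‖)
    (hC : 0 < C) (hy₀ : y₀ ∈ Yset) (hz₀ : F y₀ ∈ Zset)
    (T₀ : ℝ) (hT₀ : 0 < T₀)
    (hctrb : ∀ z ∈ Zset, ∀ y1 ∈ lvl F z, ∀ y2 ∈ lvl F z,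
      ∃ u y T, IsControl Uset u ∧ IsSolOn (fun s x => f (u s) x) y ∧
        y 0 = y1 ∧ 0 ≤ T ∧ T ≤ T₀ ∧ y T = y2) :
    Assumption2 Uset f F Zset := by
  obtain ⟨L, hL⟩ := hfL
  obtain ⟨V, -, hYV, hFV, -⟩ := hF
  have hK : ∀ z ∈ Zset, IsCompact (lvl F z) := fun z hz => by
    have he : lvl F z = Yset ∩ F ⁻¹' {z} :=
      Subset.antisymm (fun y hy => ⟨hYzY z hz hy, hy⟩) fun y hy => hy.2
    refine hY.of_isClosed_subset ?_ (hYzY z hz)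
    rw [he]
    exact (hFV.continuousOn.mono hYV).preimage_isClosed_of_isClosed hY.isClosed isClosed_singleton
  have hJ : ∀ z ∈ Zset, Joinable Uset f (lvl F z) T₀ := fun z hz p hp x hx => by
    obtain ⟨u, y, T, hu, hy, h0, hT0, hT, hyT⟩ := hctrb z hz p hp x hx
    obtain ⟨u', w, hw, hwy⟩ := exists_traj_of_isSolOn hu hy
    exact ⟨u', w, hw, (hwy 0 le_rfl).trans h0, T, ⟨hT0, hT⟩, (hwy T hT0).trans hyT⟩
  have hne : Uset.Nonempty := by
    obtain ⟨u, -, -, hu, -⟩ := hctrb _ hz₀ y₀ rfl y₀ rfl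
    exact ⟨u 0, hu.2 0 le_rfl⟩
  set b : ℝ → ℝ≥0∞ := fun S =>
    ⨆ z ∈ Zset, ⨆ y ∈ lvl F z, ⨆ μ ∈ W Uset f F z, ρpt μ (Mz Uset f S y) with hb
  have hb1 : ∀ S > (0:ℝ), b S ≤ 1 := fun S hS =>
    iSup₂_le fun z hz => iSup₂_le fun y hy => iSup₂_le fun μ hμ => by
      have := hμ.1
      exact ρpt_le_one hU hne hfC hL hS y
  refine ⟨fun S => (b S).toReal, ?_, fun z hz y hy S hS μ hμ => ?_⟩
  · refine Metric.tendsto_atTop.2 fun ε hε => ?_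
    obtain ⟨S₀, -, h⟩ :=
      exists_forall_ρpt_le hU hY hfC hL hYzY hK hT₀.le hJ (half_pos hε)
    refine ⟨S₀, fun S hS => ?_⟩
    have hle : b S ≤ ENNReal.ofReal (ε / 2) :=
      iSup₂_le fun z hz => iSup₂_le fun y hy => iSup₂_le fun μ hμ => h S hS z hz y hy μ hμ
    rw [Real.dist_0_eq_abs, abs_of_nonneg ENNReal.toReal_nonneg]
    exact (ENNReal.toReal_le_of_le_ofReal (half_pos hε).le hle).trans_lt (half_lt_self hε)
  · rw [ENNReal.ofReal_toReal ((hb1 S hS).trans_lt ENNReal.one_lt_top).ne]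
    exact le_iSup₂_of_le z hz (le_iSup₂_of_le y hy (le_iSup₂_of_le μ hμ le_rfl))

end SlowObs
end
end

section
/- Assume the reduced system is uncontrolled, y′(τ) = f(y(τ)), and Assumption III holds. Then for every z ∈ Z, W(z) = {μ ∈ P(U×Y) : μ(du,dy) = σ(du|y) ν_z(dy) for some Borel measurable family y ↦ σ(du|y) of probability measures on U}; equivalently, a measure μ ∈ P(U×Y) belongs to W(z) if and only if the marginal of μ on Y equals ν_z. -/
open MeasureTheory Set Filter Metric
open scoped ENNReal NNReal Topology

noncomputable section

namespace SlowObs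

variable {d m k : ℕ}

/-- The coordinatewise truncation of a Euclidean vector to the cube `[-R, R]ᵐ`. -/
def clamp {m : ℕ} (R : ℝ) (x : Em m) : Em m :=
  WithLp.toLp 2 fun i => max (-R) (min R (x i))

lemma lipschitzWith_clamp {m : ℕ} (R : ℝ) : LipschitzWith 1 (clamp (m := m) R) := by
  refine LipschitzWith.of_dist_le_mul fun x y => ?_
  rw [NNReal.coe_one, one_mul, EuclideanSpace.dist_eq, EuclideanSpace.dist_eq]
  refine Real.sqrt_le_sqrt (Finset.sum_le_sum fun i _ => ?_)
  gcongr
  simp only [clamp, Real.dist_eq]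
  calc |max (-R) (min R (x i)) - max (-R) (min R (y i))|
      ≤ |min R (x i) - min R (y i)| := by
        simpa using abs_max_sub_max_le_max (-R) (min R (x i)) (-R) (min R (y i))
    _ ≤ |x i - y i| := by
        simpa using abs_min_sub_min_le_max R (x i) R (y i)

lemma clamp_eq_self {m : ℕ} {R : ℝ} {x : Em m} (hx : ‖x‖ ≤ R) : clamp R x = x := by
  ext i
  have h := abs_le.1 ((Real.norm_eq_abs _ ▸ PiLp.norm_apply_le x i).trans hx)
  simp [clamp, h.1, h.2]

lemma norm_clamp_le {m : ℕ} {R : ℝ} (hR : 0 ≤ R) (x : Em m) : ‖clamp R x‖ ≤ ‖x‖ := by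
  have h0 : clamp R (0 : Em m) = 0 := clamp_eq_self (by simpa using hR)
  simpa [h0] using (lipschitzWith_clamp R).dist_le_mul x 0

lemma norm_clamp_le_sqrt {m : ℕ} {R : ℝ} (hR : 0 ≤ R) (x : Em m) :
    ‖clamp R x‖ ≤ Real.sqrt (m * R ^ 2) := by
  rw [EuclideanSpace.norm_eq]
  refine Real.sqrt_le_sqrt ?_
  calc ∑ i, ‖clamp R x i‖ ^ 2 ≤ ∑ _i : Fin m, R ^ 2 := by
        refine Finset.sum_le_sum fun i _ => ?_
        rw [Real.norm_eq_abs, sq_abs]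
        refine sq_le_sq' (le_max_left _ _) (max_le (by linarith) (min_le_left _ _))
    _ = m * R ^ 2 := by simp

lemma norm_le_of_lipschitzWith {E : Type*} [NormedAddCommGroup E] {L : ℝ≥0} {f : E → E}
    (hf : LipschitzWith L f) (x : E) : ‖f x‖ ≤ L * ‖x‖ + ‖f 0‖ := by
  have h := hf.dist_le_mul x 0
  rw [dist_eq_norm, dist_zero_right] at h
  linarith [norm_le_norm_add_norm_sub (f 0) (f x), norm_sub_rev (f 0) (f x)]

/-- A Lipschitz vector field coincides on any given ball with a bounded Lipschitz one of no larger
growth. -/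
lemma exists_bounded_lipschitzWith_eqOn {m : ℕ} {L : ℝ≥0} {f : Em m → Em m}
    (hf : LipschitzWith L f) {R : ℝ} (hR : 0 ≤ R) :
    ∃ g : Em m → Em m, LipschitzWith L g ∧ (∃ M : ℝ≥0, ∀ x, ‖g x‖ ≤ M) ∧
      (∀ x, ‖g x‖ ≤ L * ‖x‖ + ‖f 0‖) ∧ ∀ x, ‖x‖ ≤ R → g x = f x := by
  refine ⟨f ∘ clamp R, by simpa using hf.comp (lipschitzWith_clamp R),
    ⟨L * (Real.sqrt (m * R ^ 2)).toNNReal + ‖f 0‖₊, fun x => ?_⟩, fun x => ?_,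
    fun x hx => by simp [clamp_eq_self hx]⟩
  · refine (norm_le_of_lipschitzWith hf _).trans ?_
    rw [NNReal.coe_add, NNReal.coe_mul, Real.coe_toNNReal _ (Real.sqrt_nonneg _), coe_nnnorm]
    gcongr
    exact norm_clamp_le_sqrt hR x
  · refine (norm_le_of_lipschitzWith hf _).trans ?_
    gcongr
    exact norm_clamp_le hR x

section Curves

variable {E : Type*} [NormedAddCommGroup E] [NormedSpace ℝ E] {L : ℝ≥0} {f : E → E}

lemma hasDerivWithinAt_Ici_of_Icc {y : ℝ → E} {y' : E} {t T : ℝ} (ht : t ∈ Ico 0 T)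
    (h : HasDerivWithinAt y y' (Icc 0 T) t) : HasDerivWithinAt y y' (Ici t) t :=
  h.mono_of_mem_nhdsWithin (mem_of_superset (Icc_mem_nhdsGE ht.2) (Icc_subset_Icc_left ht.1))

lemma dist_le_of_isIntegralCurveOn_Icc (hf : LipschitzWith L f) {y₁ y₂ : ℝ → E} {T : ℝ}
    (h₁ : IsIntegralCurveOn y₁ (fun _ => f) (Icc 0 T))
    (h₂ : IsIntegralCurveOn y₂ (fun _ => f) (Icc 0 T)) {t : ℝ} (ht : t ∈ Icc 0 T) :
    dist (y₁ t) (y₂ t) ≤ dist (y₁ 0) (y₂ 0) * Real.exp (L * t) := by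
  simpa using dist_le_of_trajectories_ODE (fun _ => hf) h₁.continuousOn
    (fun s hs => hasDerivWithinAt_Ici_of_Icc hs (h₁ s (Ico_subset_Icc_self hs))) h₂.continuousOn
    (fun s hs => hasDerivWithinAt_Ici_of_Icc hs (h₂ s (Ico_subset_Icc_self hs))) le_rfl t ht

lemma dist_le_of_isIntegralCurveOn_Ici (hf : LipschitzWith L f) {y₁ y₂ : ℝ → E}
    (h₁ : IsIntegralCurveOn y₁ (fun _ => f) (Ici 0))
    (h₂ : IsIntegralCurveOn y₂ (fun _ => f) (Ici 0)) {t : ℝ} (ht : 0 ≤ t) :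
    dist (y₁ t) (y₂ t) ≤ dist (y₁ 0) (y₂ 0) * Real.exp (L * t) :=
  dist_le_of_isIntegralCurveOn_Icc hf (h₁.mono Icc_subset_Ici_self) (h₂.mono Icc_subset_Ici_self)
    (right_mem_Icc.2 ht)

lemma eq_of_isIntegralCurveOn_Ici (hf : LipschitzWith L f) {y₁ y₂ : ℝ → E}
    (h₁ : IsIntegralCurveOn y₁ (fun _ => f) (Ici 0))
    (h₂ : IsIntegralCurveOn y₂ (fun _ => f) (Ici 0)) (h0 : y₁ 0 = y₂ 0) {t : ℝ} (ht : 0 ≤ t) :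
    y₁ t = y₂ t := by
  simpa [h0] using dist_le_of_isIntegralCurveOn_Ici hf h₁ h₂ ht

lemma isIntegralCurveOn_Ici_comp_add {y : ℝ → E}
    (h : IsIntegralCurveOn y (fun _ => f) (Ici 0)) {s : ℝ} (hs : 0 ≤ s) :
    IsIntegralCurveOn (fun t => y (t + s)) (fun _ => f) (Ici 0) := by
  intro t ht
  have h1 := (h (t + s) (add_nonneg ht hs)).scomp t
    ((hasDerivAt_id t).add_const s).hasDerivWithinAt (s := Ici 0)
    (fun r hr => add_nonneg (mem_Ici.1 hr) hs)
  simpa [Function.comp_def] using h1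

lemma integral_eq_sub_of_isIntegralCurveOn (hf : Continuous f) {y : ℝ → E} [CompleteSpace E]
    (h : IsIntegralCurveOn y (fun _ => f) (Ici 0)) {t : ℝ} (ht : 0 ≤ t) :
    ∫ s in (0 : ℝ)..t, f (y s) = y t - y 0 := by
  refine intervalIntegral.integral_eq_sub_of_hasDeriv_right_of_le ht
    (h.continuousOn.mono Icc_subset_Ici_self)
    (fun s hs => (h s hs.1.le).mono (Ioi_subset_Ici hs.1.le)) ?_
  refine ContinuousOn.intervalIntegrable (hf.comp_continuousOn (h.continuousOn.mono ?_))
  rw [uIcc_of_le ht]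
  exact Icc_subset_Ici_self

/-- Integral curves on all the intervals `[0, N]` glue to one on `[0, ∞)`. -/
lemma exists_isIntegralCurveOn_Ici_of_Icc (hf : LipschitzWith L f) {x : E}
    (h : ∀ N : ℕ, ∃ y : ℝ → E, y 0 = x ∧ IsIntegralCurveOn y (fun _ => f) (Icc 0 N)) :
    ∃ y : ℝ → E, y 0 = x ∧ IsIntegralCurveOn y (fun _ => f) (Ici 0) := by
  choose y hy0 hy using h
  have key : ∀ {N N' : ℕ} {t : ℝ}, 0 ≤ t → t ≤ N → t ≤ N' → y N t = y N' t := by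
    intro N N' t h0 h1 h2
    simpa [hy0] using dist_le_of_isIntegralCurveOn_Icc hf ((hy N).mono (Icc_subset_Icc_right h1))
      ((hy N').mono (Icc_subset_Icc_right h2)) (right_mem_Icc.2 h0)
  refine ⟨fun t => y ⌈t⌉₊ t, hy0 _, fun t ht => ?_⟩
  obtain ⟨N, hN⟩ := exists_nat_gt t
  have heq : ∀ s ∈ Icc (0 : ℝ) N, y ⌈s⌉₊ s = y N s := fun s hs => key hs.1 (Nat.le_ceil s) hs.2
  have hmem : Icc (0 : ℝ) N ∈ 𝓝[Ici 0] t := by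
    rw [← Ici_inter_Iic]
    exact inter_mem_nhdsWithin _ (Iic_mem_nhds hN)
  have htN : t ∈ Icc (0 : ℝ) N := ⟨ht, hN.le⟩
  have h1 := (hy N t htN).mono_of_mem_nhdsWithin hmem
  rw [← heq t htN] at h1
  exact h1.congr_of_eventuallyEq (mem_of_superset hmem heq) (heq t htN)

/-- A bounded Lipschitz vector field has integral curves on `[0, T]`. -/
lemma exists_isIntegralCurveOn_Icc_of_bounded [CompleteSpace E] (hf : LipschitzWith L f) {M : ℝ≥0}
    (hM : ∀ x, ‖f x‖ ≤ M) (x : E) {T : ℝ} (hT : 0 ≤ T) :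
    ∃ y : ℝ → E, y 0 = x ∧ IsIntegralCurveOn y (fun _ => f) (Icc 0 T) := by
  have hp : IsPicardLindelof (fun _ => f) (⟨0, left_mem_Icc.2 hT⟩ : Icc 0 T) x
      (M * T.toNNReal) 0 M L :=
    { lipschitzOnWith := fun _ _ => hf.lipschitzOnWith
      continuousOn := fun _ _ => continuousOn_const
      norm_le := fun _ _ y _ => hM y
      mul_max_le := by simp [hT] }
  exact hp.exists_eq_forall_mem_Icc_hasDerivWithinAt₀

end Curves

/-- Global forward existence for Lipschitz vector fields. -/
lemma exists_isIntegralCurveOn_Ici {m : ℕ} {L : ℝ≥0} {f : Em m → Em m}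
    (hf : LipschitzWith L f) (x : Em m) :
    ∃ y : ℝ → Em m, y 0 = x ∧ IsIntegralCurveOn y (fun _ => f) (Ici 0) := by
  refine exists_isIntegralCurveOn_Ici_of_Icc hf fun N => ?_
  set B := fun t : ℝ => gronwallBound ‖x‖ L ‖f 0‖ t with hB
  have hBmono : Monotone B := gronwallBound_mono (norm_nonneg _) (norm_nonneg _) L.2
  have hB0 : 0 ≤ B N := by
    have : B 0 = ‖x‖ := gronwallBound_x0 _ _ _
    linarith [hBmono (Nat.cast_nonneg N : (0 : ℝ) ≤ N), norm_nonneg x]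
  obtain ⟨g, hgL, ⟨M, hM⟩, hgrow, hgf⟩ := exists_bounded_lipschitzWith_eqOn hf hB0
  obtain ⟨y, hy0, hy⟩ := exists_isIntegralCurveOn_Icc_of_bounded hgL hM x (Nat.cast_nonneg N)
  have hbound : ∀ t ∈ Icc (0 : ℝ) N, ‖y t‖ ≤ B N := by
    intro t ht
    have := norm_le_gronwallBound_of_norm_deriv_right_le hy.continuousOn
      (fun s hs => hasDerivWithinAt_Ici_of_Icc hs (hy s (Ico_subset_Icc_self hs)))
      (by rw [hy0]) (fun s _ => hgrow (y s)) t ht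
    rw [sub_zero] at this
    exact this.trans (hBmono ht.2)
  refine ⟨y, hy0, fun t ht => ?_⟩
  simpa only [hgf _ (hbound t ht)] using hy t ht

/-- `Φ` assigns to each point the integral curve of `f` starting there, defined on `[0, ∞)` and
extended continuously to `ℝ`. -/
structure IsForwardFlow {E : Type*} [NormedAddCommGroup E] [NormedSpace ℝ E] (f : E → E)
    (Φ : ℝ → E → E) : Prop where
  zero : ∀ x, Φ 0 x = x
  cont : ∀ x, Continuous fun t => Φ t x
  curve : ∀ x, IsIntegralCurveOn (fun t => Φ t x) (fun _ => f) (Ici 0)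

lemma exists_isForwardFlow {m : ℕ} {L : ℝ≥0} {f : Em m → Em m} (hf : LipschitzWith L f) :
    ∃ Φ : ℝ → Em m → Em m, IsForwardFlow f Φ := by
  choose y hy0 hy using fun x => exists_isIntegralCurveOn_Ici hf x
  refine ⟨fun t x => y x (max t 0), fun x => by simp [hy0], fun x => ?_, fun x t ht => ?_⟩
  · exact (hy x).continuousOn.comp_continuous (by fun_prop) fun t => le_max_right t 0
  · have ht' : max t 0 = t := max_eq_left ht
    have h := hy x t ht
    simp only [ht']
    exact h.congr (fun s hs => by rw [max_eq_left (mem_Ici.1 hs)]) (by rw [ht'])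

namespace IsForwardFlow

variable {E : Type*} [NormedAddCommGroup E] [NormedSpace ℝ E] {L M : ℝ≥0} {f : E → E}
  {Φ : ℝ → E → E}

lemma add (hf : LipschitzWith L f) (hΦ : IsForwardFlow f Φ) {s t : ℝ} (hs : 0 ≤ s) (ht : 0 ≤ t)
    (x : E) : Φ s (Φ t x) = Φ (s + t) x :=
  eq_of_isIntegralCurveOn_Ici hf (hΦ.curve _) (isIntegralCurveOn_Ici_comp_add (hΦ.curve x) ht)
    (by simp [hΦ.zero]) hs

lemma dist_le (hf : LipschitzWith L f) (hΦ : IsForwardFlow f Φ) {t T : ℝ} (ht : t ∈ Icc 0 T)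
    (x y : E) : dist (Φ t x) (Φ t y) ≤ Real.exp (L * T) * dist x y := by
  have h := dist_le_of_isIntegralCurveOn_Ici hf (hΦ.curve x) (hΦ.curve y) ht.1
  rw [hΦ.zero, hΦ.zero] at h
  refine h.trans ?_
  rw [mul_comm]
  gcongr
  exact ht.2

lemma norm_sub_le [CompleteSpace E] (hf : LipschitzWith L f) (hM : ∀ x, ‖f x‖ ≤ M)
    (hΦ : IsForwardFlow f Φ) {t : ℝ} (ht : 0 ≤ t) (x : E) : ‖Φ t x - x‖ ≤ M * t := by
  have h := integral_eq_sub_of_isIntegralCurveOn hf.continuous (hΦ.curve x) ht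
  rw [hΦ.zero] at h
  rw [← h]
  simpa [abs_of_nonneg ht] using
    intervalIntegral.norm_integral_le_of_norm_le_const (a := 0) (b := t)
      (f := fun s => f (Φ s x)) (C := M) fun s _ => hM _

lemma norm_sub_sub_le [CompleteSpace E] (hf : LipschitzWith L f) (hM : ∀ x, ‖f x‖ ≤ M)
    (hΦ : IsForwardFlow f Φ) {t : ℝ} (ht : 0 ≤ t) (x : E) :
    ‖Φ t x - (x + t • f x)‖ ≤ L * M * t ^ 2 := by
  have h := integral_eq_sub_of_isIntegralCurveOn hf.continuous (hΦ.curve x) ht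
  rw [hΦ.zero] at h
  have hint : ∫ s in (0 : ℝ)..t, (f (Φ s x) - f x) = Φ t x - (x + t • f x) := by
    rw [intervalIntegral.integral_sub, h]
    · simp [sub_sub]
    · exact (hf.continuous.comp (hΦ.cont x)).intervalIntegrable _ _
    · exact intervalIntegrable_const
  rw [← hint]
  refine (intervalIntegral.norm_integral_le_of_norm_le_const (C := L * (M * t))
    fun s hs => ?_).trans (le_of_eq ?_)
  · rw [uIoc_of_le ht] at hs
    rw [← dist_eq_norm]
    refine (hf.dist_le_mul _ _).trans ?_
    rw [dist_eq_norm]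
    gcongr
    exact (hΦ.norm_sub_le hf hM hs.1.le x).trans (by gcongr; exact hs.2)
  · rw [sub_zero, abs_of_nonneg ht]; ring

end IsForwardFlow

section Invariance

variable {E : Type*} [NormedAddCommGroup E] [NormedSpace ℝ E] [FiniteDimensional ℝ E]
  [MeasurableSpace E] [BorelSpace E]

/-- Mollifying a Lipschitz function `ψ` whose derivative along the Lipschitz vector field `f` is the
Lipschitz function `G` gives smooth functions whose derivative along `f` is uniformly close
to `G`. -/
lemma exists_contDiff_abs_fderiv_sub_le {L C₁ C₂ : ℝ≥0} {f : E → E} {ψ G : E → ℝ}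
    (hf : LipschitzWith L f) (hψ : LipschitzWith C₁ ψ) (hG : LipschitzWith C₂ G) {C : ℝ}
    (hC : ∀ v, ∀ t : ℝ, 0 ≤ t → |ψ (v + t • f v) - ψ v - t * G v| ≤ C * t ^ 2)
    {ε : ℝ} (hε : 0 < ε) :
    ∃ η : E → ℝ, ContDiff ℝ 1 η ∧ ∀ x, |fderiv ℝ η x (f x) - G x| ≤ (C₁ * L + C₂) * ε := by
  let μ : Measure E := Measure.addHaar
  let φ : ContDiffBump (0 : E) := ⟨ε / 2, ε, by positivity, by linarith⟩
  let η : E → ℝ := convolution (φ.normed μ) ψ (ContinuousLinearMap.lsmul ℝ ℝ) μ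
  have hη : ContDiff ℝ 1 η :=
    φ.hasCompactSupport_normed.contDiff_convolution_left _ φ.contDiff_normed
      hψ.continuous.locallyIntegrable
  have hconv : ∀ (g : E → ℝ), Continuous g → ∀ x,
      Integrable (fun w => φ.normed μ w • g (x - w)) μ := fun g hg x =>
    φ.hasCompactSupport_normed.convolutionExists_left (ContinuousLinearMap.lsmul ℝ ℝ)
      φ.continuous_normed hg.locallyIntegrable x
  have hC0 : 0 ≤ C := by simpa using (abs_nonneg _).trans (hC 0 1 zero_le_one)
  have key : ∀ x, ∀ t : ℝ, 0 ≤ t →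
      |η (x + t • f x) - η x - t * G x| ≤ C * t ^ 2 + t * ((C₁ * L + C₂) * ε) := by
    intro x t ht
    let g : E → ℝ := fun v => ψ (v + t • f x) - ψ v
    have hgc : Continuous g :=
      (hψ.continuous.comp (continuous_id.add continuous_const)).sub hψ.continuous
    have hg : convolution (φ.normed μ) g (ContinuousLinearMap.lsmul ℝ ℝ) μ x
        = η (x + t • f x) - η x := by
      simp only [η, g, convolution_def, ContinuousLinearMap.lsmul_apply]
      rw [← integral_sub (hconv ψ hψ.continuous _) (hconv ψ hψ.continuous _)]
      refine integral_congr_ae (.of_forall fun w => ?_)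
      simp only [smul_sub]
      rw [sub_add_eq_add_sub]
    rw [← hg, ← Real.dist_eq]
    refine dist_convolution_le (R := ε) (by positivity) φ.support_normed_eq.subset
      φ.nonneg_normed φ.integral_normed hgc.aestronglyMeasurable fun v hv => ?_
    have hvx : ‖v - x‖ ≤ ε := (dist_eq_norm v x ▸ (mem_ball.1 hv)).le
    have h1 : |ψ (v + t • f x) - ψ (v + t • f v)| ≤ t * (C₁ * L * ε) := by
      rw [← Real.dist_eq]
      refine (hψ.dist_le_mul _ _).trans ?_
      rw [dist_add_left, dist_smul₀, Real.norm_of_nonneg ht]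
      have := hf.dist_le_mul x v
      rw [dist_comm x v, dist_eq_norm v x] at this
      calc (C₁ : ℝ) * (t * dist (f x) (f v)) ≤ C₁ * (t * (L * ε)) := by
            gcongr
            exact this.trans (by gcongr)
        _ = _ := by ring
    have h2 : |t * G v - t * G x| ≤ t * (C₂ * ε) := by
      rw [← mul_sub, abs_mul, abs_of_nonneg ht, ← Real.dist_eq]
      gcongr
      refine (hG.dist_le_mul _ _).trans ?_
      rw [dist_eq_norm]
      gcongr
    have h3 := hC v t ht
    rw [Real.dist_eq]
    simp only [g]
    rw [abs_le] at h1 h2 h3 ⊢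
    constructor <;> linarith
  refine ⟨η, hη, fun x => ?_⟩
  have hd : HasDerivAt (fun t : ℝ => η (x + t • f x)) (fderiv ℝ η x (f x)) 0 := by
    have h1 : HasDerivAt (fun t : ℝ => x + t • f x) (f x) 0 := by
      simpa using ((hasDerivAt_id (0 : ℝ)).smul_const (f x)).const_add x
    have h2 : HasFDerivAt η (fderiv ℝ η x) (x + (0 : ℝ) • f x) := by
      simpa using (hη.differentiable one_ne_zero x).hasFDerivAt
    exact h2.comp_hasDerivAt 0 h1
  have hs := (hd.tendsto_slope_zero_right.sub_const (G x)).abs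
  have hr : Tendsto (fun t : ℝ => C * t + (C₁ * L + C₂) * ε) (𝓝[>] 0)
      (𝓝 ((C₁ * L + C₂) * ε)) := by
    have : Continuous fun t : ℝ => C * t + (C₁ * L + C₂) * ε := by fun_prop
    simpa using (this.tendsto 0).mono_left nhdsWithin_le_nhds
  refine le_of_tendsto_of_tendsto hs hr ?_
  filter_upwards [self_mem_nhdsWithin] with t ht
  have ht : 0 < t := ht
  have hk := key x t ht.le
  simp only [zero_add, zero_smul, add_zero, smul_eq_mul]
  have : t⁻¹ * (η (x + t • f x) - η x) - G x = t⁻¹ * (η (x + t • f x) - η x - t * G x) := by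
    field_simp
  rw [this, abs_mul, abs_of_pos (inv_pos.2 ht), inv_mul_le_iff₀ ht]
  linarith

lemma integral_eq_zero_of_lipschitz_derivative {ν : Measure E} [IsFiniteMeasure ν]
    {L C₁ C₂ : ℝ≥0} {f : E → E} {ψ G : E → ℝ} (hf : LipschitzWith L f)
    (hν : ∀ φ : E → ℝ, ContDiff ℝ 1 φ → ∫ x, fderiv ℝ φ x (f x) ∂ν = 0)
    (hψ : LipschitzWith C₁ ψ) (hG : LipschitzWith C₂ G) {B : ℝ} (hB : ∀ x, |G x| ≤ B) {C : ℝ}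
    (hC : ∀ v, ∀ t : ℝ, 0 ≤ t → |ψ (v + t • f v) - ψ v - t * G v| ≤ C * t ^ 2) :
    ∫ x, G x ∂ν = 0 := by
  have hGi : Integrable G ν :=
    .of_bound hG.continuous.aestronglyMeasurable B (.of_forall hB)
  have key : ∀ ε : ℝ, 0 < ε → |∫ x, G x ∂ν| ≤ (C₁ * L + C₂) * ε * ν.real univ := by
    intro ε hε
    obtain ⟨η, hη, hηG⟩ := exists_contDiff_abs_fderiv_sub_le hf hψ hG hC hε
    have hDc : Continuous fun x => fderiv ℝ η x (f x) :=
      (hη.continuous_fderiv one_ne_zero).clm_apply hf.continuous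
    have hDi : Integrable (fun x => fderiv ℝ η x (f x)) ν := by
      refine .of_bound hDc.aestronglyMeasurable (B + (C₁ * L + C₂) * ε) (.of_forall fun x => ?_)
      have h1 := abs_le.1 (hB x)
      have h2 := abs_le.1 (hηG x)
      rw [Real.norm_eq_abs, abs_le]
      constructor <;> linarith
    have h := norm_integral_le_of_norm_le_const (μ := ν)
      (f := fun x => fderiv ℝ η x (f x) - G x) (.of_forall hηG)
    rwa [integral_sub hDi hGi, hν η hη, zero_sub, norm_neg, Real.norm_eq_abs] at h
  have hlim : Tendsto (fun ε : ℝ => (C₁ * L + C₂) * ε * ν.real univ) (𝓝[>] 0) (𝓝 0) := by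
    have : Continuous fun ε : ℝ => (C₁ * L + C₂) * ε * ν.real univ := by fun_prop
    simpa using (this.tendsto 0).mono_left nhdsWithin_le_nhds
  have := ge_of_tendsto hlim (eventually_nhdsWithin_of_forall (s := Ioi 0) key)
  exact abs_nonpos_iff.1 this

lemma integral_comp_add_sub_integral {k : ℝ → ℝ} (hk : Continuous k) (S t : ℝ) :
    (∫ s in (0 : ℝ)..S, k (s + t)) - ∫ s in (0 : ℝ)..S, k s
      = ∫ s in (0 : ℝ)..t, (k (s + S) - k s) := by
  have hi : ∀ a b, IntervalIntegrable k volume a b := fun a b => hk.intervalIntegrable a b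
  rw [intervalIntegral.integral_sub
      (Continuous.intervalIntegrable (by fun_prop : Continuous fun s => k (s + S)) _ _) (hi _ _),
    intervalIntegral.integral_comp_add_right, intervalIntegral.integral_comp_add_right,
    zero_add, zero_add, add_comm t S]
  have h1 := intervalIntegral.integral_add_adjacent_intervals (hi 0 t) (hi t (S + t))
  have h2 := intervalIntegral.integral_add_adjacent_intervals (hi 0 S) (hi S (S + t))
  linarith

/-- A finite measure annihilating all derivatives along a bounded Lipschitz vector field is
invariant under its flow. -/
lemma integral_comp_flow_eq {ν : Measure E} [IsFiniteMeasure ν] {L M : ℝ≥0} {f : E → E}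
    (hf : LipschitzWith L f) (hM : ∀ x, ‖f x‖ ≤ M) {Φ : ℝ → E → E} (hΦ : IsForwardFlow f Φ)
    (hν : ∀ φ : E → ℝ, ContDiff ℝ 1 φ → ∫ x, fderiv ℝ φ x (f x) ∂ν = 0)
    {q : E → ℝ} {K : ℝ≥0} (hq : LipschitzWith K q) {B : ℝ} (hB : ∀ x, |q x| ≤ B)
    {S : ℝ} (hS : 0 ≤ S) : ∫ x, q (Φ S x) ∂ν = ∫ x, q x ∂ν := by
  have : CompleteSpace E := FiniteDimensional.complete ℝ E
  obtain ⟨A, hA⟩ : ∃ A : ℝ≥0, (A : ℝ) = K * Real.exp (L * S) :=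
    ⟨⟨K * Real.exp (L * S), by positivity⟩, rfl⟩
  have hqΦ : ∀ s ∈ Icc 0 S, LipschitzWith A fun x => q (Φ s x) := by
    refine fun s hs => LipschitzWith.of_dist_le_mul fun x y => ?_
    refine (hq.dist_le_mul _ _).trans ?_
    rw [hA, mul_assoc]
    gcongr
    exact hΦ.dist_le hf hs x y
  have hqc : ∀ x, Continuous fun s => q (Φ s x) := fun x => hq.continuous.comp (hΦ.cont x)
  set ψ : E → ℝ := fun x => ∫ s in (0 : ℝ)..S, q (Φ s x) with hψdef
  set G : E → ℝ := fun x => q (Φ S x) - q x with hGdef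
  have hψ : LipschitzWith (A * S.toNNReal) ψ := by
    refine LipschitzWith.of_dist_le_mul fun x y => ?_
    rw [Real.dist_eq, hψdef, ← intervalIntegral.integral_sub ((hqc x).intervalIntegrable _ _)
      ((hqc y).intervalIntegrable _ _), ← Real.norm_eq_abs]
    refine (intervalIntegral.norm_integral_le_of_norm_le_const (C := A * dist x y)
      fun s hs => ?_).trans (le_of_eq ?_)
    · rw [uIoc_of_le hS] at hs
      rw [← dist_eq_norm]
      exact (hqΦ s (Ioc_subset_Icc_self hs)).dist_le_mul x y
    · rw [sub_zero, abs_of_nonneg hS, NNReal.coe_mul, Real.coe_toNNReal _ hS]; ring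
  have hG : LipschitzWith (A + K) G := (hqΦ S (right_mem_Icc.2 hS)).sub hq
  have hGb : ∀ x, |G x| ≤ B + B := fun x => (abs_sub _ _).trans (add_le_add (hB _) (hB _))
  have hzero : ∫ x, G x ∂ν = 0 := by
    refine integral_eq_zero_of_lipschitz_derivative hf hν hψ hG hGb
      (C := A * S.toNNReal * (L * M) + (A + K) * M) fun v t ht => ?_
    have h1 : |ψ (v + t • f v) - ψ (Φ t v)| ≤ A * S.toNNReal * (L * M * t ^ 2) := by
      rw [← Real.dist_eq, dist_comm]
      refine (hψ.dist_le_mul _ _).trans ?_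
      rw [NNReal.coe_mul, dist_eq_norm]
      gcongr
      exact hΦ.norm_sub_sub_le hf hM ht v
    have h2 : ψ (Φ t v) - ψ v - t * G v = ∫ s in (0 : ℝ)..t, (G (Φ s v) - G v) := by
      have e1 : ψ (Φ t v) = ∫ s in (0 : ℝ)..S, q (Φ (s + t) v) := by
        refine intervalIntegral.integral_congr fun s hs => ?_
        rw [uIcc_of_le hS] at hs
        simp only [hΦ.add hf hs.1 ht]
      have e2 : ∫ s in (0 : ℝ)..t, (G (Φ s v) - G v)
          = ∫ s in (0 : ℝ)..t, ((q (Φ (s + S) v) - q (Φ s v)) - G v) := by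
        refine intervalIntegral.integral_congr fun s hs => ?_
        rw [uIcc_of_le ht] at hs
        simp only [hGdef, hΦ.add hf hS hs.1, add_comm S s]
      have e3 := integral_comp_add_sub_integral (hqc v) S t
      rw [e2, intervalIntegral.integral_sub, ← e3, e1]
      · simp [hψdef]
      · exact (((hqc v).comp (continuous_id.add continuous_const)).sub
          (hqc v)).intervalIntegrable _ _
      · exact intervalIntegrable_const
    have h3 : |ψ (Φ t v) - ψ v - t * G v| ≤ (A + K) * M * t ^ 2 := by
      rw [h2, ← Real.norm_eq_abs]
      refine (intervalIntegral.norm_integral_le_of_norm_le_const (C := (A + K) * (M * t))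
        fun s hs => ?_).trans (le_of_eq ?_)
      · rw [uIoc_of_le ht] at hs
        rw [← dist_eq_norm]
        refine (hG.dist_le_mul _ _).trans ?_
        rw [NNReal.coe_add, dist_eq_norm]
        gcongr
        exact (hΦ.norm_sub_le hf hM hs.1.le v).trans (by gcongr; exact hs.2)
      · rw [sub_zero, abs_of_nonneg ht]; ring
    rw [abs_le] at h1 h3 ⊢
    constructor <;> linarith
  have hi1 : Integrable (fun x => q (Φ S x)) ν :=
    .of_bound (hqΦ S (right_mem_Icc.2 hS)).continuous.aestronglyMeasurable B
      (.of_forall fun x => hB _)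
  have hi2 : Integrable q ν := .of_bound hq.continuous.aestronglyMeasurable B (.of_forall hB)
  rw [hGdef, integral_sub hi1 hi2] at hzero
  linarith

end Invariance

lemma ext_of_forall_lipschitz_integral_eq {Ω : Type*} [PseudoMetricSpace Ω]
    [MeasurableSpace Ω] [BorelSpace Ω] {μ ν : Measure Ω} [IsProbabilityMeasure μ]
    [IsProbabilityMeasure ν]
    (h : ∀ (q : Ω → ℝ) (K : ℝ≥0) (B : ℝ), LipschitzWith K q → (∀ x, |q x| ≤ B) →
      ∫ x, q x ∂μ = ∫ x, q x ∂ν) : μ = ν := by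
  let μ' : ProbabilityMeasure Ω := ⟨μ, inferInstance⟩
  let ν' : ProbabilityMeasure Ω := ⟨ν, inferInstance⟩
  have ht : Tendsto (fun _ : ℕ => μ') atTop (𝓝 ν') := by
    refine tendsto_iff_forall_lipschitz_integral_tendsto.2 fun q ⟨C, hC⟩ ⟨K, hK⟩ => ?_
    obtain ⟨B, hB⟩ : ∃ B : ℝ, ∀ x, |q x| ≤ B := by
      rcases isEmpty_or_nonempty Ω with _ | ⟨⟨a⟩⟩
      · exact ⟨0, isEmptyElim⟩
      · refine ⟨C + |q a|, fun x => ?_⟩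
        have h1 := hC x a
        rw [Real.dist_eq] at h1
        linarith [abs_sub_abs_le_abs_sub (q x) (q a)]
    change Tendsto (fun _ : ℕ => ∫ x, q x ∂μ) atTop (𝓝 (∫ x, q x ∂ν))
    rw [h q K B hK hB]
    exact tendsto_const_nhds
  have heq : μ' = ν' := tendsto_nhds_unique tendsto_const_nhds ht
  exact congrArg Subtype.val heq

section Periodic

variable {E : Type*} [NormedAddCommGroup E]

lemma continuous_of_periodic_of_continuousOn_Ici {y : ℝ → E} {T : ℝ} (hT : 0 < T)
    (hper : Function.Periodic y T) (h : ContinuousOn y (Ici 0)) : Continuous y := by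
  refine continuous_iff_continuousAt.2 fun t => ?_
  obtain ⟨n, hn⟩ := exists_nat_gt (-t / T)
  have hpos : 0 < t + n * T := by
    rw [div_lt_iff₀ hT] at hn
    linarith
  have h1 : ContinuousAt (fun s => y (s + n * T)) t :=
    ContinuousAt.comp (f := fun s => s + n * T) (g := y) (h.continuousAt (Ici_mem_nhds hpos))
      (by fun_prop)
  exact h1.congr (.of_forall fun s => hper.nat_mul n s)

variable [NormedSpace ℝ E] [CompleteSpace E]

lemma hasDerivAt_of_periodic_of_integral_eq {f : E → E} (hf : Continuous f) {y : ℝ → E} {T : ℝ}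
    (hT : 0 < T) (hper : Function.Periodic y T) (hy : Continuous y)
    (h : ∀ t : ℝ, 0 ≤ t → y t = y 0 + ∫ s in (0 : ℝ)..t, f (y s)) (t : ℝ) :
    HasDerivAt y (f (y t)) t := by
  obtain ⟨n, hn⟩ := exists_nat_gt (-t / T)
  have hpos : 0 < t + n * T := by
    rw [div_lt_iff₀ hT] at hn
    linarith
  have h1 : HasDerivAt y (f (y (t + n * T))) (t + n * T) := by
    refine HasDerivAt.congr_of_eventuallyEq
      (((hf.comp hy).integral_hasStrictDerivAt 0 (t + n * T)).hasDerivAt.const_add (y 0)) ?_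
    filter_upwards [Ici_mem_nhds hpos] with s hs using h s hs
  have h2 : HasDerivAt (fun s => y (s + n * T)) (f (y (t + n * T))) t :=
    h1.comp_add_const t (n * T)
  rw [show (fun s => y (s + n * T)) = y from funext (hper.nat_mul n)] at h2
  rwa [hper.nat_mul n t] at h2

end Periodic

section OccupationalMeasure

variable {m : ℕ} {y : ℝ → Em m} {T : ℝ}

lemma isProbabilityMeasure_perOcc (hy : Continuous y) (hT : 0 < T) :
    IsProbabilityMeasure (perOcc y T) := by
  refine ⟨?_⟩
  rw [perOcc, Measure.smul_apply, Measure.map_apply hy.measurable .univ, preimage_univ,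
    Measure.restrict_apply_univ, Real.volume_Ioc, sub_zero, smul_eq_mul,
    ENNReal.inv_mul_cancel (by simpa using hT) ENNReal.ofReal_ne_top]

lemma integral_perOcc (hy : Continuous y) (hT : 0 < T) {q : Em m → ℝ} (hq : Continuous q) :
    ∫ x, q x ∂perOcc y T = T⁻¹ * ∫ s in (0 : ℝ)..T, q (y s) := by
  rw [perOcc, integral_smul_measure, integral_map hy.aemeasurable hq.aestronglyMeasurable,
    intervalIntegral.integral_of_le hT.le, ENNReal.toReal_inv, ENNReal.toReal_ofReal hT.le,
    smul_eq_mul]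

lemma ae_perOcc_of_forall (hy : Continuous y) {p : Em m → Prop} (hp : MeasurableSet {x | p x})
    (h : ∀ t, p (y t)) : ∀ᵐ x ∂perOcc y T, p x :=
  Measure.ae_smul_measure ((ae_map_iff hy.aemeasurable hp).2 (.of_forall h)) _

lemma integral_fderiv_perOcc {f : Em m → Em m} (hf : Continuous f) (hT : 0 < T)
    (hper : Function.Periodic y T) (hy : ∀ t, HasDerivAt y (f (y t)) t) {φ : Em m → ℝ}
    (hφ : ContDiff ℝ 1 φ) : ∫ x, fderiv ℝ φ x (f x) ∂perOcc y T = 0 := by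
  have hyc : Continuous y := continuous_iff_continuousAt.2 fun t => (hy t).continuousAt
  have hDc : Continuous fun x => fderiv ℝ φ x (f x) :=
    (hφ.continuous_fderiv one_ne_zero).clm_apply hf
  rw [integral_perOcc hyc hT hDc, intervalIntegral.integral_eq_sub_of_hasDerivAt
    (f := fun s => φ (y s))
    (fun t _ => (hφ.differentiable one_ne_zero (y t)).hasFDerivAt.comp_hasDerivAt t (hy t))
    ((hDc.comp hyc).intervalIntegrable _ _)]
  rw [show y T = y 0 by simpa using hper 0, sub_self, mul_zero]

/-- A probability measure carried by a periodic orbit of `f` and annihilating all derivatives along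
`f` is the occupational measure of the orbit. -/
lemma eq_perOcc_of_integral_fderiv_eq_zero {L : ℝ≥0} {f : Em m → Em m} (hf : LipschitzWith L f)
    (hT : 0 < T) (hper : Function.Periodic y T) (hy : ∀ t, HasDerivAt y (f (y t)) t)
    {ν : Measure (Em m)} [IsProbabilityMeasure ν] (hrange : ∀ᵐ x ∂ν, x ∈ range y)
    (hν : ∀ φ : Em m → ℝ, ContDiff ℝ 1 φ → ∫ x, fderiv ℝ φ x (f x) ∂ν = 0) :
    ν = perOcc y T := by
  have hyc : Continuous y := continuous_iff_continuousAt.2 fun t => (hy t).continuousAt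
  have := isProbabilityMeasure_perOcc hyc hT
  obtain ⟨R, hR⟩ := (hper.isBounded_of_continuous hT.ne' hyc).exists_norm_le
  have hR' : ∀ t, ‖y t‖ ≤ R := fun t => hR _ (mem_range_self t)
  obtain ⟨g, hg, ⟨M, hM⟩, -, hgf⟩ :=
    exists_bounded_lipschitzWith_eqOn hf ((norm_nonneg _).trans (hR' 0))
  have hνg : ∀ φ : Em m → ℝ, ContDiff ℝ 1 φ → ∫ x, fderiv ℝ φ x (g x) ∂ν = 0 := fun φ hφ => by
    rw [← hν φ hφ]
    refine integral_congr_ae ?_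
    filter_upwards [hrange] with x hx
    rw [hgf x (hR x hx)]
  obtain ⟨Φ, hΦ⟩ := exists_isForwardFlow hg
  have horbit : ∀ r t : ℝ, 0 ≤ t → Φ t (y r) = y (t + r) := fun r t ht =>
    eq_of_isIntegralCurveOn_Ici hg (hΦ.curve _)
      (y₂ := fun t => y (t + r)) (fun t _ => by
        have h := (hy (t + r)).comp_add_const t r
        rw [← hgf _ (hR' _)] at h
        exact h.hasDerivWithinAt) (by simp [hΦ.zero]) ht
  refine ext_of_forall_lipschitz_integral_eq fun q K B hq hB => ?_
  let c : ℝ → ℝ := fun s => max 0 (min T s)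
  have hc : ∀ s, c s ∈ Icc 0 T := fun s => ⟨le_max_left _ _, max_le hT.le (min_le_left _ _)⟩
  have hcs : ∀ s ∈ uIcc 0 T, c s = s := fun s hs => by
    rw [uIcc_of_le hT.le] at hs
    simp [c, hs.1, hs.2]
  have hcont : Continuous (Function.uncurry fun s x => q (Φ (c s) x)) := by
    refine continuous_prod_of_continuous_lipschitzWith' _
      (K * ⟨Real.exp (L * T), by positivity⟩) (fun s => ?_) fun x => ?_
    · refine hq.comp (LipschitzWith.of_dist_le_mul fun x x' => hΦ.dist_le hg (hc s) x x')
    · exact hq.continuous.comp ((hΦ.cont x).comp (by fun_prop))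
  have : IsFiniteMeasure (volume.restrict (uIoc 0 T)) := ⟨by simp [uIoc_of_le hT.le]⟩
  have hswap := intervalIntegral_integral_swap (a := 0) (b := T) (μ := ν)
    (f := fun s x => q (Φ (c s) x))
    (.of_bound hcont.aestronglyMeasurable B (.of_forall fun p => hB _))
  have hleft : ∫ s in (0 : ℝ)..T, ∫ x, q (Φ (c s) x) ∂ν = T * ∫ x, q x ∂ν := by
    simp_rw [fun s => integral_comp_flow_eq hg hM hΦ hνg hq hB (hc s).1]
    simp
  have hright : ∫ x, (∫ s in (0 : ℝ)..T, q (Φ (c s) x)) ∂ν = ∫ s in (0 : ℝ)..T, q (y s) := by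
    have : ∀ᵐ x ∂ν, ∫ s in (0 : ℝ)..T, q (Φ (c s) x) = ∫ s in (0 : ℝ)..T, q (y s) := by
      filter_upwards [hrange] with x hx
      obtain ⟨r, rfl⟩ := hx
      have hqper : Function.Periodic (fun s => q (y s)) T := fun s => congrArg q (hper s)
      calc ∫ s in (0 : ℝ)..T, q (Φ (c s) (y r)) = ∫ s in (0 : ℝ)..T, q (y (s + r)) := by
            refine intervalIntegral.integral_congr fun s hs => ?_
            simp only [horbit r _ (hc s).1]
            rw [hcs s hs]
        _ = ∫ s in r..r + T, q (y s) := by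
            rw [intervalIntegral.integral_comp_add_right fun s => q (y s), zero_add, add_comm T]
        _ = ∫ s in (0 : ℝ)..T, q (y s) := by
            simpa using hqper.intervalIntegral_add_eq r 0
    rw [integral_congr_ae this]
    simp
  rw [integral_perOcc hyc hT hq.continuous, ← hright, ← hswap, hleft,
    inv_mul_cancel_left₀ hT.ne']

end OccupationalMeasure

lemma IsForwardFlow.isSolOn {m : ℕ} {f : Em m → Em m} (hf : Continuous f)
    {Φ : ℝ → Em m → Em m} (hΦ : IsForwardFlow f Φ) (x : Em m) :
    IsSolOn (fun _ x => f x) fun t => Φ t x := by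
  refine ⟨(hΦ.cont x).continuousOn,
    fun T => (hf.comp (hΦ.cont x)).intervalIntegrable _ _, fun t ht => ?_⟩
  rw [integral_eq_sub_of_isIntegralCurveOn hf (hΦ.curve x) ht, add_sub_cancel]

lemma isClosed_lvl {m k : ℕ} {F : Em m → Kk k} {Y : Set (Em m)} (hY : IsClosed Y)
    (hF : ContinuousOn F Y) {z : Kk k} (hz : lvl F z ⊆ Y) : IsClosed (lvl F z) := by
  have h := hF.preimage_isClosed_of_isClosed hY (isClosed_singleton (x := z))
  rwa [show Y ∩ F ⁻¹' {z} = lvl F z from inter_eq_right.2 hz] at h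

/-- Proposition 4.1(i) of the paper: for an uncontrolled reduced system
satisfying Assumption III, `W(z)` consists exactly of the probability measures on `U × Y`
whose marginal on the state space equals the occupational measure `ν_z` of the periodic orbit. -/
theorem statement8
    {d m k : ℕ}
    (Uset : Set (Dd d)) (Yset : Set (Em m)) (Zset : Set (Kk k))
    (f0 : Em m → Em m) (F : Em m → Kk k)
    (hU : IsCompact Uset) (hY : IsCompact Yset) (hZ : IsCompact Zset)
    (hfL : ∃ L : ℝ≥0, LipschitzWith L f0)
    (hF : ∃ V : Set (Em m), IsOpen V ∧ Yset ⊆ V ∧ ContDiffOn ℝ 1 F V ∧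
      ∃ LF : ℝ≥0, LipschitzOnWith LF (fun y => fderiv ℝ F y) V)
    (hInv : ∀ y ∈ Yset, fderiv ℝ F y (f0 y) = 0)
    (hYzY : ∀ z ∈ Zset, lvl F z ⊆ Yset)
    (yper : Kk k → ℝ → Em m) (Tper : Kk k → ℝ)
    (hIII : AssumptionIII f0 F Zset yper Tper) :
    ∀ z ∈ Zset, W Uset (fun _ : Dd d => f0) F z =
      {μ : Measure (Dd d × Em m) | IsProbabilityMeasure μ ∧
        μ (Uset ×ˢ (univ : Set (Em m))) = 1 ∧
        μ.map Prod.snd = perOcc (yper z) (Tper z)} := by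
  intro z hz
  obtain ⟨L, hL⟩ := hfL
  obtain ⟨V, -, hYV, hFV, -⟩ := hF
  obtain ⟨⟨_, hT⟩, hsol, hlvl, hper, hshift⟩ := hIII
  have hT := (hT z hz).1
  have hper : Function.Periodic (yper z) (Tper z) := hper z hz
  obtain ⟨hcont, -, hint⟩ := hsol z hz
  have hyc := continuous_of_periodic_of_continuousOn_Ici hT hper hcont
  have hy := hasDerivAt_of_periodic_of_integral_eq hL.continuous hT hper hyc hint
  have hclosed : IsClosed (lvl F z) :=
    isClosed_lvl hY.isClosed (hFV.continuousOn.mono hYV) (hYzY z hz)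
  have hrange : lvl F z ⊆ range (yper z) := fun x hx => by
    obtain ⟨Φ, hΦ⟩ := exists_isForwardFlow hL
    obtain ⟨s, hs⟩ := hshift z hz _ (hΦ.isSolOn hL.continuous x) (by simpa [hΦ.zero] using hx)
    exact ⟨0 + s, by rw [← hs 0 le_rfl, hΦ.zero]⟩
  have hprod : MeasurableSet (Uset ×ˢ lvl F z) := hU.measurableSet.prod hclosed.measurableSet
  have hprod' : MeasurableSet (Uset ×ˢ (univ : Set (Em m))) := hU.measurableSet.prod .univ
  have hmap : ∀ (μ : Measure (Dd d × Em m)) (φ : Em m → ℝ), ContDiff ℝ 1 φ →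
      ∫ x, fderiv ℝ φ x (f0 x) ∂μ.map Prod.snd = ∫ p, fderiv ℝ φ p.2 (f0 p.2) ∂μ :=
    fun μ φ hφ => integral_map measurable_snd.aemeasurable
      ((hφ.continuous_fderiv one_ne_zero).clm_apply hL.continuous).aestronglyMeasurable
  ext μ
  constructor
  · rintro ⟨hμ, hsupp, hμ0⟩
    have hae := (mem_ae_iff_prob_eq_one hprod).2 hsupp
    refine ⟨hμ, (mem_ae_iff_prob_eq_one hprod').1 ?_, ?_⟩
    · filter_upwards [hae] with p hp using ⟨hp.1, mem_univ _⟩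
    · have := Measure.isProbabilityMeasure_map (μ := μ) (f := Prod.snd)
        measurable_snd.aemeasurable
      refine eq_perOcc_of_integral_fderiv_eq_zero hL hT hper hy ?_ fun φ hφ => ?_
      · have : ∀ᵐ x ∂μ.map Prod.snd, x ∈ lvl F z := by
          refine (ae_map_iff measurable_snd.aemeasurable hclosed.measurableSet).2 ?_
          filter_upwards [hae] with p hp using hp.2
        filter_upwards [this] with x hx using hrange hx
      · rw [hmap μ φ hφ]
        exact hμ0 φ hφ
  · rintro ⟨hμ, hsupp, hν⟩
    refine ⟨hμ, (mem_ae_iff_prob_eq_one hprod).1 ?_, fun φ hφ => ?_⟩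
    · have h1 : ∀ᵐ x ∂μ.map Prod.snd, x ∈ lvl F z := by
        rw [hν]
        exact ae_perOcc_of_forall hyc hclosed.measurableSet (hlvl z hz)
      filter_upwards [(mem_ae_iff_prob_eq_one hprod').2 hsupp,
        ae_of_ae_map measurable_snd.aemeasurable h1] with p hp hp' using ⟨hp.1, hp'⟩
    · rw [← hmap μ φ hφ, hν]
      exact integral_fderiv_perOcc hL.continuous hT hper hy hφ

end SlowObs
end
end
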